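/- arXiv:2212.05887 — 11 statements merged into one kernel-verified Lean document; each statement's English description precedes it below -/
import Mathlib

section
/- Let $n,m$ be positive integers and let $f:\mathbb{F}_2^n\to\mathbb{F}_2^m$ be any function. Let $\delta$ be a positive integer such that for every nonzero $a\in\mathbb{F}_2^n$ and every $b\in\mathbb{F}_2^m$, the number of $x\in\mathbb{F}_2^n$ with $f(x)+f(x+a)=b$ is at most $\delta$. Then for every affine map $\alpha:\mathbb{F}_2^n\to\mathbb{F}_2^m$ one has $|\{x\in\mathbb{F}_2^n\mid f(x)\neq\alpha(x)\}|\geq 2^n-\sqrt{\delta}\cdot 2^{n/2}-\tfrac{1}{2}$ (as an inequality of real numbers). In particular the vectorial nonlinearity of $f$ satisfies $\mathrm{NL}_{v}(f)\geq 2^n-\sqrt{\delta}\cdot 2^{n/2}-\tfrac{1}{2}$. -/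
/-- A set on which `f` agrees with an affine map `α` has few ordered pairs of distinct elements
when the derivatives of `f` have small fibres. -/
theorem card_offDiag_filter_eq_affine_le {V W : Type*} [AddCommGroup V] [Fintype V]
    [DecidableEq V] [AddCommGroup W] [DecidableEq W] (hV : ∀ x : V, x + x = 0)
    (hW : ∀ x : W, x + x = 0) (f α : V → W) (δ : ℕ)
    (hdiff : ∀ a : V, a ≠ 0 → ∀ b : W,
      (Finset.univ.filter fun x => f x + f (x + a) = b).card ≤ δ)
    (hα : ∀ x y z, α (x + y + z) = α x + α y + α z) :
    (Finset.univ.filter fun x => f x = α x).offDiag.card ≤ δ * (Fintype.card V - 1) := by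
  rw [← Finset.card_univ, ← Finset.card_erase_of_mem (Finset.mem_univ (0 : V))]
  refine Finset.card_le_mul_card_image_of_maps_to (f := fun p : V × V => p.1 + p.2) ?_ δ ?_
  · rintro ⟨x, y⟩ hxy
    simp only [Finset.mem_offDiag] at hxy
    refine Finset.mem_erase.2 ⟨fun h => hxy.2.2 ?_, Finset.mem_univ _⟩
    exact add_right_cancel (h.trans (hV y).symm)
  · intro a ha
    refine le_trans ?_ (hdiff a (Finset.ne_of_mem_erase ha) (α a + α 0))
    have snd_eq : ∀ x y : V, x + y = a → y = x + a := by
      rintro x y rfl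
      rw [← add_assoc, hV, zero_add]
    refine Finset.card_le_card_of_injOn Prod.fst ?_ ?_
    · rintro ⟨x, y⟩ hxy
      simp only [Finset.coe_filter, Finset.mem_offDiag, Finset.mem_filter, Finset.mem_univ,
        true_and, Set.mem_ofPred_eq] at hxy ⊢
      obtain ⟨⟨hx, hy, -⟩, h⟩ := hxy
      rw [← snd_eq x y h, hx, hy, snd_eq x y h]
      have h0 := hα x a 0
      rw [add_zero] at h0
      rw [h0, ← add_assoc, ← add_assoc, hW, zero_add]
    · rintro ⟨x, y⟩ hxy ⟨x', y'⟩ hxy' h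
      simp only [Finset.coe_filter, Set.mem_ofPred_eq] at hxy hxy' h
      rw [snd_eq x y hxy.2, snd_eq x' y' hxy'.2, h]

/-- Improved Carlet-type lower bound on the vectorial nonlinearity in terms of an
upper bound `δ` on the differential uniformity: for every affine map `α`,
`d_H(f, α) ≥ 2^n - √δ · 2^(n/2) - 1/2`. -/
theorem vectorial_nonlinearity_lower_bound (n m : ℕ) (hn : 0 < n) (hm : 0 < m)
    (f : (Fin n → ZMod 2) → (Fin m → ZMod 2)) (δ : ℕ) (hδ : 0 < δ)
    (hdiff : ∀ a : Fin n → ZMod 2, a ≠ 0 → ∀ b : Fin m → ZMod 2,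
      (Finset.univ.filter fun x => f x + f (x + a) = b).card ≤ δ)
    (α : (Fin n → ZMod 2) → (Fin m → ZMod 2))
    (hα : ∀ x y z, α (x + y + z) = α x + α y + α z) :
    (2 : ℝ) ^ n - Real.sqrt δ * (2 : ℝ) ^ ((n : ℝ) / 2) - 1 / 2 ≤
      ((Finset.univ.filter fun x => f x ≠ α x).card : ℝ) := by
  have char_two : ∀ k : ℕ, ∀ x : Fin k → ZMod 2, x + x = 0 :=
    fun k x => funext fun i => CharTwo.add_self_eq_zero (x i)
  have hpairs := card_offDiag_filter_eq_affine_le (char_two n) (char_two m) f α δ hdiff hα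
  have hsplit := Finset.card_filter_add_card_filter_not
    (s := (Finset.univ : Finset (Fin n → ZMod 2))) (fun x => f x = α x)
  have hcard : Fintype.card (Fin n → ZMod 2) = 2 ^ n := by simp
  rw [Finset.card_univ, hcard] at hsplit
  rw [Finset.offDiag_card, hcard] at hpairs
  set k := (Finset.univ.filter fun x => f x = α x).card
  have hk : (k : ℝ) + ((Finset.univ.filter fun x => f x ≠ α x).card : ℝ) = 2 ^ n := by
    exact_mod_cast hsplit
  have hsq : (k : ℝ) * k - k ≤ δ * (2 ^ n - 1) := by
    have h : ((k * k - k : ℕ) : ℝ) ≤ ((δ * (2 ^ n - 1) : ℕ) : ℝ) := by exact_mod_cast hpairs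
    rw [Nat.cast_sub (Nat.le_mul_self k), Nat.cast_mul, Nat.cast_mul,
      Nat.cast_sub Nat.one_le_two_pow] at h
    exact_mod_cast h
  have hpow : (2 : ℝ) ^ ((n : ℝ) / 2) = Real.sqrt (2 ^ n) := by
    rw [Real.sqrt_eq_rpow, ← Real.rpow_natCast, ← Real.rpow_mul (by norm_num)]
    ring_nf
  have hδ' : (1 : ℝ) ≤ δ := by exact_mod_cast hδ
  have hle : (k : ℝ) - 1 / 2 ≤ Real.sqrt (δ * 2 ^ n) := by
    apply Real.le_sqrt_of_sq_le
    nlinarith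
  rw [hpow, ← Real.sqrt_mul (Nat.cast_nonneg δ)]
  linarith
end

section
/- Let $n$ be a positive integer and let $f:\mathbb{F}_2^n\to\mathbb{F}_2^n$ be an APN function, i.e., for every nonzero $a\in\mathbb{F}_2^n$ and every $b\in\mathbb{F}_2^n$, the number of $x\in\mathbb{F}_2^n$ with $f(x)+f(x+a)=b$ is at most $2$. Then the vectorial nonlinearity of $f$ satisfies $\mathrm{NL}_{v}(f)\geq 2^n-\sqrt{2}\cdot 2^{n/2}-\tfrac{1}{2}$ (as an inequality of real numbers). -/
/-- A set on which an APN function agrees with an affine map is a Sidon set, hence small. -/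
theorem card_mul_card_sub_one_le_of_apn_eq_affine {V W : Type*} [AddCommGroup V] [Fintype V]
    [DecidableEq V] [AddCommGroup W] [DecidableEq W] (hV : ∀ x : V, x + x = 0)
    (hW : ∀ x : W, x + x = 0) (f α : V → W)
    (hAPN : ∀ a : V, a ≠ 0 → ∀ b : W,
      (Finset.univ.filter fun x => f x + f (x + a) = b).card ≤ 2)
    (hα : ∀ x y z, α (x + y + z) = α x + α y + α z) :
    (Finset.univ.filter fun x => f x = α x).card *
        ((Finset.univ.filter fun x => f x = α x).card - 1) ≤
      2 * (Fintype.card V - 1) := by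
  set S := Finset.univ.filter fun x => f x = α x with hS
  have hmaps : ∀ p ∈ S.offDiag, p.1 + p.2 ∈ (Finset.univ : Finset V).erase 0 := by
    intro p hp
    refine Finset.mem_erase.2 ⟨fun h => (Finset.mem_offDiag.1 hp).2.2 ?_, Finset.mem_univ _⟩
    exact add_right_cancel (h.trans (hV p.2).symm)
  have hfib : ∀ a ∈ (Finset.univ : Finset V).erase 0,
      (S.offDiag.filter fun p => p.1 + p.2 = a).card ≤ 2 := by
    intro a ha
    refine le_trans ?_ (hAPN a (Finset.ne_of_mem_erase ha) (α 0 + α a))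
    refine Finset.card_le_card_of_injOn Prod.fst ?_ ?_
    · rintro ⟨x, y⟩ hp
      simp only [hS, Finset.coe_filter, Finset.mem_offDiag, Finset.mem_filter, Finset.mem_univ,
        true_and, Set.mem_ofPred_eq] at hp ⊢
      obtain ⟨⟨hx, hy, -⟩, rfl⟩ := hp
      have hxy : x + (x + y) = y := by rw [← add_assoc, hV, zero_add]
      have h := hα x 0 (x + y)
      rw [add_zero, hxy] at h
      rw [hxy, hx, hy, h, add_assoc (α x), ← add_assoc (α x) (α x), hW, zero_add]
    · rintro ⟨x, y⟩ hp ⟨x', y'⟩ hp' (rfl : x = x')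
      simp only [Finset.coe_filter, Set.mem_ofPred_eq] at hp hp'
      exact Prod.ext rfl (add_left_cancel (hp.2.trans hp'.2.symm))
  have h := Finset.card_le_mul_card_image_of_maps_to hmaps 2 hfib
  rw [Finset.offDiag_card, Finset.card_erase_of_mem (Finset.mem_univ _), Finset.card_univ] at h
  rwa [Nat.mul_sub, mul_one]


/-- For an APN function `f : 𝔽₂ⁿ → 𝔽₂ⁿ`, the vectorial nonlinearity satisfies
`NL_v(f) ≥ 2^n - √2 · 2^(n/2) - 1/2`, i.e. every affine map `α` satisfies
`d_H(f, α) ≥ 2^n - √2 · 2^(n/2) - 1/2`. -/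
theorem apn_vectorial_nonlinearity_lower_bound (n : ℕ) (hn : 0 < n)
    (f : (Fin n → ZMod 2) → (Fin n → ZMod 2))
    (hAPN : ∀ a : Fin n → ZMod 2, a ≠ 0 → ∀ b : Fin n → ZMod 2,
      (Finset.univ.filter fun x => f x + f (x + a) = b).card ≤ 2)
    (α : (Fin n → ZMod 2) → (Fin n → ZMod 2))
    (hα : ∀ x y z, α (x + y + z) = α x + α y + α z) :
    (2 : ℝ) ^ n - Real.sqrt 2 * (2 : ℝ) ^ ((n : ℝ) / 2) - 1 / 2 ≤
      ((Finset.univ.filter fun x => f x ≠ α x).card : ℝ) := by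
  have h2 : ∀ x : Fin n → ZMod 2, x + x = 0 := fun x => funext fun i => CharTwo.add_self_eq_zero _
  have h := card_mul_card_sub_one_le_of_apn_eq_affine h2 h2 f α hAPN hα
  have hsum := Finset.card_filter_add_card_filter_not
    (s := (Finset.univ : Finset (Fin n → ZMod 2))) (fun x => f x = α x)
  have hcard : Fintype.card (Fin n → ZMod 2) = 2 ^ n := by simp [ZMod.card]
  rw [Finset.card_univ, hcard] at hsum
  rw [hcard] at h
  change _ ≤ ((Finset.univ.filter fun x => ¬ f x = α x).card : ℝ)
  generalize (Finset.univ.filter fun x => f x = α x).card = k at h hsum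
  generalize (Finset.univ.filter fun x => ¬ f x = α x).card = d at hsum ⊢
  have hsumR : (k : ℝ) + d = 2 ^ n := by exact_mod_cast hsum
  have hsq : (Real.sqrt 2 * (2 : ℝ) ^ ((n : ℝ) / 2)) ^ 2 = 2 * 2 ^ n := by
    rw [mul_pow, Real.sq_sqrt zero_le_two, ← Real.rpow_mul_natCast zero_le_two]
    simp
  have hk : (k : ℝ) * (k - 1) ≤ 2 * (2 ^ n - 1) := by
    rcases k with _ | k
    · have : (1 : ℝ) ≤ 2 ^ n := one_le_pow₀ one_le_two
      simpa using this
    · have h' : (k + 1) * k + 2 ≤ 2 * 2 ^ n := by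
        have : 1 ≤ 2 ^ n := Nat.one_le_two_pow
        rw [Nat.add_sub_cancel] at h
        omega
      have : ((k : ℝ) + 1) * k + 2 ≤ 2 * 2 ^ n := by exact_mod_cast h'
      push_cast
      linarith
  have hle : (k : ℝ) - 1 / 2 ≤ Real.sqrt 2 * (2 : ℝ) ^ ((n : ℝ) / 2) := by
    refine le_of_abs_le (abs_le_of_sq_le_sq ?_ (by positivity))
    rw [hsq]
    linarith
  linarith
end

section
/- Let $m\geq 4$ be an even integer and $q=2^m$. Let $H=\{(x,y)\in\mathbb{F}_q\times\mathbb{F}_q\mid xy=1\}$ be the canonical hyperbola in the affine plane over $\mathbb{F}_q$. Then $H$ is a complete Sidon set in the additive group $\mathbb{F}_q\times\mathbb{F}_q$: $H$ is a Sidon set, and for every point $P\in(\mathbb{F}_q\times\mathbb{F}_q)\setminus H$, the set $H\cup\{P\}$ is not a Sidon set. -/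
/-- Three of the four elements `x, y, z, w` are pairwise different. -/
def ThreeDistinct {A : Type*} (x y z w : A) : Prop :=
  (x ≠ y ∧ x ≠ z ∧ y ≠ z) ∨ (x ≠ y ∧ x ≠ w ∧ y ≠ w) ∨
    (x ≠ z ∧ x ≠ w ∧ z ≠ w) ∨ (y ≠ z ∧ y ≠ w ∧ z ≠ w)

/-- `S` is a Sidon set in the abelian group `A`: for any `x, y, z, w ∈ S`
of which at least three are pairwise different, `x + y ≠ z + w`. -/
def IsSidon {A : Type*} [AddCommGroup A] (S : Set A) : Prop :=
  ∀ x ∈ S, ∀ y ∈ S, ∀ z ∈ S, ∀ w ∈ S, ThreeDistinct x y z w → x + y ≠ z + w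

section ArtinSchreier

open Polynomial

variable {F : Type*} [Field F]

/-- The polynomial `X + X² + X⁴ + ⋯ + X^(2^(n-1))`; over a field of order `2^n` it evaluates to the
absolute trace. -/
noncomputable def tracePoly (F : Type*) [Field F] (n : ℕ) : F[X] :=
  ∑ i ∈ Finset.range n, X ^ 2 ^ i

theorem tracePoly_eval (n : ℕ) (x : F) :
    (tracePoly F n).eval x = ∑ i ∈ Finset.range n, x ^ 2 ^ i := by
  simp [tracePoly, eval_finsetSum]

theorem tracePoly_monic_natDegree (n : ℕ) :
    (tracePoly F (n + 1)).Monic ∧ (tracePoly F (n + 1)).natDegree = 2 ^ n := by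
  have h : (∑ i ∈ Finset.range n, (X : F[X]) ^ 2 ^ i).degree < (2 ^ n : ℕ) := by
    refine (degree_sum_le _ _).trans_lt ((Finset.sup_lt_iff ?_).2 fun i hi => ?_)
    · exact WithBot.bot_lt_coe _
    · rw [degree_X_pow]
      exact_mod_cast Nat.pow_lt_pow_right one_lt_two (Finset.mem_range.1 hi)
  rw [tracePoly, Finset.sum_range_succ, add_comm]
  exact ⟨monic_X_pow_add h, natDegree_eq_of_degree_eq_some
    ((degree_add_eq_left_of_degree_lt (by rwa [degree_X_pow])).trans (degree_X_pow _))⟩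

theorem tracePoly_coeff_two_pow {n i : ℕ} (h : i < n) : (tracePoly F n).coeff (2 ^ i) = 1 := by
  simp [tracePoly, coeff_X_pow, h]

theorem tracePoly_coeff_six (n : ℕ) : (tracePoly F n).coeff 6 = 0 := by
  rw [tracePoly, finsetSum_coeff]
  refine Finset.sum_eq_zero fun i _ => ?_
  rw [coeff_X_pow, if_neg]
  intro h
  have hi : i < 3 := (Nat.pow_lt_pow_iff_right one_lt_two).1 (h ▸ by norm_num)
  interval_cases i <;> simp at h

/-- The numerator of `1 + Tr (X / D)` over the denominator `D^(2^n)`. -/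
noncomputable def traceNumerator (n : ℕ) (D : F[X]) : F[X] :=
  ∑ i ∈ Finset.range (n + 1), X ^ 2 ^ i * D ^ (2 ^ n - 2 ^ i) + D ^ 2 ^ n

theorem traceNumerator_eval (n : ℕ) (D : F[X]) {w : F} (hD : D.eval w ≠ 0) :
    (traceNumerator n D).eval w =
      D.eval w ^ 2 ^ n * ((tracePoly F (n + 1)).eval (w / D.eval w) + 1) := by
  simp only [traceNumerator, tracePoly, eval_add, eval_finsetSum, eval_mul, eval_pow, eval_X,
    mul_add, mul_one, Finset.mul_sum]
  congr 1
  refine Finset.sum_congr rfl fun i hi => ?_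
  have hi : 2 ^ i ≤ 2 ^ n :=
    Nat.pow_le_pow_right two_pos (Nat.lt_succ_iff.1 (Finset.mem_range.1 hi))
  rw [div_pow, pow_sub₀ _ hD hi]
  ring

theorem natDegree_traceNumerator_le (n : ℕ) {D : F[X]} (hD : D.natDegree ≤ 1) :
    (traceNumerator n D).natDegree ≤ 2 ^ n := by
  have hpow (k : ℕ) : (D ^ k).natDegree ≤ k :=
    natDegree_pow_le.trans ((Nat.mul_le_mul_left k hD).trans (mul_one k).le)
  refine natDegree_add_le_of_degree_le (natDegree_sum_le_of_forall_le _ _ fun i hi => ?_) (hpow _)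
  have hi : 2 ^ i ≤ 2 ^ n :=
    Nat.pow_le_pow_right two_pos (Nat.lt_succ_iff.1 (Finset.mem_range.1 hi))
  refine natDegree_mul_le.trans ?_
  rw [natDegree_X_pow]
  have := hpow (2 ^ n - 2 ^ i)
  omega

variable [CharP F 2]

theorem tracePoly_eval_artinSchreier (n : ℕ) (z : F) :
    (tracePoly F n).eval (z ^ 2 + z) = z ^ 2 ^ n + z := by
  rw [tracePoly_eval]
  induction n with
  | zero => simp [CharTwo.add_self_eq_zero]
  | succ n ih =>
    rw [Finset.sum_range_succ, ih, add_pow_char_pow, ← pow_mul, ← pow_succ']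
    linear_combination CharTwo.add_self_eq_zero (z ^ 2 ^ n)

theorem tracePoly_eval_sq_add (n : ℕ) (x : F) :
    (tracePoly F n).eval x ^ 2 + (tracePoly F n).eval x = x ^ 2 ^ n + x := by
  rw [← tracePoly_eval_artinSchreier, tracePoly_eval, tracePoly_eval, CharTwo.sum_sq,
    ← Finset.sum_add_distrib]
  refine Finset.sum_congr rfl fun i _ => ?_
  rw [add_pow_char_pow, ← pow_mul, ← pow_mul, mul_comm]

theorem derivative_sq_eq_zero (f : F[X]) : derivative (f ^ 2) = 0 := by
  rw [derivative_sq, CharTwo.two_eq_zero, C_0, zero_mul, zero_mul]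

theorem derivative_tracePoly (n : ℕ) : derivative (tracePoly F (n + 1)) = 1 := by
  simp [tracePoly, Finset.sum_range_succ', pow_succ 2, pow_mul, derivative_sq_eq_zero]

section Finite

variable [Fintype F] {n : ℕ}

theorem two_pow_le_card_image_artinSchreier [DecidableEq F] (hF : Fintype.card F = 2 ^ (n + 1)) :
    2 ^ n ≤ (Finset.univ.image fun z : F => z ^ 2 + z).card := by
  have h := Finset.card_le_mul_card_image (f := fun z : F => z ^ 2 + z) Finset.univ 2 ?_
  · rw [Finset.card_univ, hF, pow_succ'] at h
    omega
  · intro b hb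
    obtain ⟨z, -, rfl⟩ := Finset.mem_image.1 hb
    refine (Finset.card_le_card fun y hy => ?_).trans (Finset.card_le_two (a := z) (b := z + 1))
    have hy : y ^ 2 + y = z ^ 2 + z := (Finset.mem_filter.1 hy).2
    have h0 : (y - z) * (y - (z + 1)) = 0 := by
      linear_combination hy - (y * z + y - z ^ 2 - z) * CharTwo.two_eq_zero (R := F)
    rcases mul_eq_zero.1 h0 with h | h
    · simp [sub_eq_zero.1 h]
    · simp [sub_eq_zero.1 h]

theorem exists_sq_add_eq_of_tracePoly_eval_eq_zero (hF : Fintype.card F = 2 ^ (n + 1)) {x : F}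
    (hx : (tracePoly F (n + 1)).eval x = 0) : ∃ z, z ^ 2 + z = x := by
  classical
  obtain ⟨hm, hd⟩ := tracePoly_monic_natDegree (F := F) n
  have hsub : (Finset.univ.image fun z : F => z ^ 2 + z) ⊆ (tracePoly F (n + 1)).roots.toFinset := by
    intro y hy
    obtain ⟨z, -, rfl⟩ := Finset.mem_image.1 hy
    rw [Multiset.mem_toFinset, mem_roots hm.ne_zero, IsRoot, tracePoly_eval_artinSchreier, ← hF,
      FiniteField.pow_card, CharTwo.add_self_eq_zero]
  have heq := Finset.eq_of_subset_of_card_le hsub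
    (((Multiset.toFinset_card_le _).trans (card_roots' _)).trans
      (hd.le.trans (two_pow_le_card_image_artinSchreier hF)))
  have : x ∈ (tracePoly F (n + 1)).roots.toFinset := by
    rwa [Multiset.mem_toFinset, mem_roots hm.ne_zero]
  rw [← heq] at this
  simpa using this

theorem tracePoly_dvd_of_eval_artinSchreier (hF : Fintype.card F = 2 ^ (n + 1)) {f : F[X]}
    (hf : ∀ z, f.eval (z ^ 2 + z) = 0) : tracePoly F (n + 1) ∣ f := by
  classical
  obtain ⟨hm, hd⟩ := tracePoly_monic_natDegree (F := F) n
  rw [← modByMonic_eq_zero_iff_dvd hm]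
  refine eq_zero_of_natDegree_lt_card_of_eval_eq_zero' _
    (Finset.univ.image fun z : F => z ^ 2 + z) ?_ ?_
  · intro y hy
    obtain ⟨z, -, rfl⟩ := Finset.mem_image.1 hy
    have h := congrArg (eval (z ^ 2 + z)) (modByMonic_add_div f (tracePoly F (n + 1)))
    rw [eval_add, eval_mul, hf, tracePoly_eval_artinSchreier, ← hF,
      FiniteField.pow_card, CharTwo.add_self_eq_zero, zero_mul, add_zero] at h
    exact h
  · refine (natDegree_modByMonic_lt f hm fun h => ?_).trans_le
      (hd.le.trans (two_pow_le_card_image_artinSchreier hF))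
    rw [h, natDegree_one] at hd
    exact (pow_pos two_pos n).ne hd

end Finite

theorem derivative_traceNumerator {n : ℕ} (hn : 0 < n) (A B : F) :
    derivative (traceNumerator n (C A + C B * X)) = C A * (C A + C B * X) ^ (2 ^ n - 2) := by
  obtain ⟨n, rfl⟩ := Nat.exists_eq_succ_of_ne_zero hn.ne'
  set D : F[X] := C A + C B * X with hD
  have hsq (i : ℕ) : X ^ 2 ^ (i + 1) * D ^ (2 ^ (n + 1) - 2 ^ (i + 1)) =
      (X ^ 2 ^ i * D ^ (2 ^ n - 2 ^ i)) ^ 2 := by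
    rw [mul_pow, ← pow_mul, ← pow_mul, Nat.sub_mul, pow_succ, pow_succ]
  obtain ⟨k, hk⟩ : ∃ k, 2 ^ n = k + 1 := ⟨2 ^ n - 1, by have := Nat.two_pow_pos n; omega⟩
  have hodd : X ^ 2 ^ 0 * D ^ (2 ^ (n + 1) - 2 ^ 0) = (D ^ k) ^ 2 * (X * D) := by
    rw [pow_succ, hk, ← pow_mul]
    have : (k + 1) * 2 - 2 ^ 0 = k * 2 + 1 := by omega
    rw [this]
    ring
  have hlast : D ^ 2 ^ (n + 1) = (D ^ 2 ^ n) ^ 2 := by rw [← pow_mul, pow_succ]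
  have hexp : 2 ^ (n + 1) - 2 = k * 2 := by rw [pow_succ, hk]; omega
  have hXD : derivative (X * D) = C A := by
    simp only [hD, derivative_mul, derivative_X, derivative_add, derivative_C]
    linear_combination C B * X * CharTwo.two_eq_zero (R := F[X])
  rw [traceNumerator, Finset.sum_range_succ', hodd, hlast, hexp, derivative_add, derivative_add,
    derivative_sq_eq_zero, derivative_mul, derivative_sq_eq_zero, hXD, derivative_sum,
    Finset.sum_eq_zero fun i _ => by rw [hsq, derivative_sq_eq_zero], pow_mul]
  ring

/-- The trace of `w` and of the Möbius image `w / (A + B w)` vanish simultaneously at some `w`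
where both are finite and nonzero. -/
theorem exists_artinSchreier_mobius [Fintype F] {n : ℕ} (hn : 3 ≤ n)
    (hF : Fintype.card F = 2 ^ (n + 1)) {A B : F} (hA : A ≠ 0) (hB : B ≠ 0) :
    ∃ z y : F, z ^ 2 + z ≠ 0 ∧ A + B * (z ^ 2 + z) ≠ 0 ∧
      (y ^ 2 + y) * (A + B * (z ^ 2 + z)) = z ^ 2 + z := by
  by_contra! hno
  set D : F[X] := C A + C B * X with hD
  set P := traceNumerator n D with hP
  set T := tracePoly F (n + 1) with hT
  have heval (w : F) : D.eval w = A + B * w := by simp [hD]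
  have hDdeg : D.natDegree ≤ 1 := by rw [hD, add_comm]; exact natDegree_linear_le
  obtain ⟨hm, hd⟩ := tracePoly_monic_natDegree (F := F) n
  have hdvd : T ∣ P * (X * D) := by
    refine tracePoly_dvd_of_eval_artinSchreier hF fun z => ?_
    rw [eval_mul, eval_mul, eval_X]
    by_cases h0 : z ^ 2 + z = 0
    · rw [h0]; ring
    by_cases h1 : D.eval (z ^ 2 + z) = 0
    · rw [h1]; ring
    rw [hP, traceNumerator_eval n D h1]
    have hne : T.eval ((z ^ 2 + z) / D.eval (z ^ 2 + z)) ≠ 0 := by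
      intro h
      obtain ⟨y, hy⟩ := exists_sq_add_eq_of_tracePoly_eval_eq_zero hF h
      refine hno z y h0 (by rwa [← heval]) ?_
      rw [← heval, hy, div_mul_cancel₀ _ h1]
    have hsq := tracePoly_eval_sq_add (n + 1) ((z ^ 2 + z) / D.eval (z ^ 2 + z))
    rw [← hF, FiniteField.pow_card, CharTwo.add_self_eq_zero] at hsq
    have : T.eval ((z ^ 2 + z) / D.eval (z ^ 2 + z)) + 1 = 0 := by
      refine (mul_eq_zero.1 ?_).resolve_left hne
      linear_combination hsq
    rw [this]
    ring
  obtain ⟨R, hR⟩ := hdvd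
  have hRdeg : R.natDegree ≤ 2 := by
    by_cases hR0 : R = 0
    · simp [hR0]
    have h1 : (P * (X * D)).natDegree ≤ 2 ^ n + (1 + 1) :=
      natDegree_mul_le_of_le (natDegree_traceNumerator_le n hDdeg)
        (natDegree_mul_le_of_le natDegree_X_le hDdeg)
    rw [hR, hm.natDegree_mul' hR0, hd] at h1
    omega
  obtain ⟨a, b, c, hRabc⟩ : ∃ a b c : F, R = C a * X ^ 2 + C b * X + C c :=
    ⟨_, _, _, eq_quadratic_of_degree_le_two (natDegree_le_iff_degree_le.1 hRdeg)⟩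
  have h2 : (2 : F[X]) = 0 := CharTwo.two_eq_zero
  have hder := congrArg derivative hR
  have hXD : derivative (X * D) = C A := by
    simp only [hD, derivative_mul, derivative_X, derivative_add, derivative_C]
    linear_combination C B * X * h2
  have hRder : derivative R = C b := by
    rw [hRabc]
    simp only [derivative_add, derivative_mul, derivative_C, derivative_X, derivative_sq_eq_zero]
    ring
  rw [derivative_mul (f := P), derivative_mul (f := T), hXD, hRder, hT, derivative_tracePoly, ← hT, hP,
    derivative_traceNumerator (by omega), ← hD, ← hP] at hder
  have hN : 8 ≤ 2 ^ n := (Nat.pow_le_pow_right two_pos hn : 2 ^ 3 ≤ 2 ^ n)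
  obtain ⟨N, hN'⟩ : ∃ N, 2 ^ n = N + 2 := ⟨2 ^ n - 2, by omega⟩
  have hDN : C A * X ^ 2 * D ^ 2 ^ n =
      X * D * R + T * (C (A * a + B * b) * X ^ 2 + C (A * c)) := by
    rw [hN', Nat.add_sub_cancel] at hder
    rw [hN', pow_add]
    simp only [C_add, C_mul]
    rw [hRabc] at hder hR ⊢
    rw [hD] at hder hR ⊢
    linear_combination (X * (C A + C B * X)) * hder - C A * hR -
      (C A * X ^ 2 * C a * T + C A * C c * T) * h2
  have hDpow : D ^ 2 ^ n = C (A ^ 2 ^ n) + C (B ^ 2 ^ n) * X ^ 2 ^ n := by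
    rw [hD, add_pow_char_pow, mul_pow, C_pow, C_pow]
  have hL : C A * X ^ 2 * D ^ 2 ^ n =
      C (A * A ^ 2 ^ n) * X ^ 2 + C (A * B ^ 2 ^ n) * X ^ (2 ^ n + 2) := by
    rw [hDpow, C_mul, C_mul]; ring
  have hM : (X * D * R).natDegree ≤ 4 :=
    natDegree_mul_le_of_le (natDegree_mul_le_of_le natDegree_X_le hDdeg) hRdeg
  have hcoeff (k : ℕ) : (T * (C (A * a + B * b) * X ^ 2 + C (A * c))).coeff (k + 2) =
      T.coeff k * (A * a + B * b) + T.coeff (k + 2) * (A * c) := by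
    rw [mul_add, ← mul_assoc, coeff_add, coeff_mul_X_pow, coeff_mul_C, coeff_mul_C]
  rw [hL] at hDN
  have h4 := congrArg (fun f => coeff f (4 + 2)) hDN
  have h6 := congrArg (fun f => coeff f (6 + 2)) hDN
  have hT4 : T.coeff 4 = 1 := tracePoly_coeff_two_pow (i := 2) (by omega)
  have hT8 : T.coeff 8 = 1 := tracePoly_coeff_two_pow (i := 3) (by omega)
  have hT6 : T.coeff 6 = 0 := tracePoly_coeff_six _
  simp only [coeff_add, coeff_C_mul_X_pow, hcoeff] at h4 h6
  rw [if_neg (by omega), if_neg (by omega), coeff_eq_zero_of_natDegree_lt (by omega)] at h4 h6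
  simp only [Nat.reduceAdd, hT4, hT6, hT8] at h4 h6
  have hδ : A * a + B * b = 0 := by linear_combination -h4
  have hγ : A * c = 0 := by linear_combination -h6
  rw [hδ, hγ] at hDN
  have htop := congrArg (fun f => coeff f (2 ^ n + 2)) hDN
  simp only [C_0, zero_mul, add_zero, mul_zero, coeff_add, coeff_C_mul_X_pow] at htop
  rw [if_neg (by omega), if_pos trivial, coeff_eq_zero_of_natDegree_lt (by omega), zero_add] at htop
  exact mul_ne_zero hA (pow_ne_zero _ hB) htop

end ArtinSchreier

section Hyperbola

variable {F : Type*} [Field F] [CharP F 2]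

theorem isSidon_hyperbola : IsSidon {p : F × F | p.1 * p.2 = 1} := by
  rintro ⟨a, a'⟩ ha ⟨b, b'⟩ hb ⟨c, c'⟩ hc ⟨d, d'⟩ hd hdist heq
  have h2 : (2 : F) = 0 := CharTwo.two_eq_zero
  simp only [Set.mem_ofPred_eq] at ha hb hc hd
  obtain ⟨h, h'⟩ := Prod.mk.inj heq
  obtain rfl : a' = a⁻¹ := eq_inv_of_mul_eq_one_right ha
  obtain rfl : b' = b⁻¹ := eq_inv_of_mul_eq_one_right hb
  obtain rfl : c' = c⁻¹ := eq_inv_of_mul_eq_one_right hc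
  obtain rfl : d' = d⁻¹ := eq_inv_of_mul_eq_one_right hd
  have hprod : (a + b) * (c * d - a * b) = 0 := by
    linear_combination a * b * c * d * h' + (-b * c * d) * ha + (-a * c * d) * hb +
      (a * b * d) * hc + (a * b * c) * hd - a * b * h
  rcases mul_eq_zero.1 hprod with h0 | h0
  · obtain rfl : a = b := by linear_combination h0 - b * h2
    obtain rfl : c = d := by linear_combination h0 - h - d * h2
    simp [ThreeDistinct] at hdist
  · have hfac : (a - c) * (a - d) = 0 := by linear_combination a * h + h0
    rcases mul_eq_zero.1 hfac with h1 | h1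
    · obtain rfl : a = c := sub_eq_zero.1 h1
      obtain rfl : b = d := add_left_cancel h
      simp [ThreeDistinct] at hdist
    · obtain rfl : a = d := sub_eq_zero.1 h1
      obtain rfl : b = c := by linear_combination h
      simp [ThreeDistinct] at hdist

variable [Fintype F]

theorem exists_add_mul_eq_mul {n : ℕ} (hn : 3 ≤ n) (hF : Fintype.card F = 2 ^ (n + 1))
    {k : F} (hk0 : k ≠ 0) (hk1 : k ≠ 1) :
    ∃ x y : F, x ≠ 0 ∧ y ≠ 0 ∧ (x + y + 1) * (x * y + x + y) = k * (x * y) := by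
  have h2 : (2 : F) = 0 := CharTwo.two_eq_zero
  obtain ⟨s, hs⟩ : ∃ s : F, s ^ 2 = k + 1 :=
    ⟨_, (surjective_frobenius F 2 (k + 1)).choose_spec⟩
  have hs0 : s ≠ 0 := by
    rintro rfl
    exact hk1 (by linear_combination -hs - h2)
  have hs1 : 1 + s ≠ 0 := by
    intro h
    exact hk0 (by linear_combination (s - 1) * h - hs)
  obtain ⟨z, y, hw, hD, hy⟩ := exists_artinSchreier_mobius hn hF hs1 (pow_ne_zero 2 hs0)
  set w := z ^ 2 + z with hwdef
  set d := 1 + s + s ^ 2 * w with hd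
  have hy0 : y ≠ 0 := by
    rintro rfl
    exact hw (by linear_combination -hy)
  set u := d / w with hu
  have huw : u * w = d := div_mul_cancel₀ _ hw
  have hu0 : u ≠ 0 := div_ne_zero hD hw
  have huy : u * (y ^ 2 + y) = 1 := by
    refine mul_right_cancel₀ hw ?_
    linear_combination (y ^ 2 + y) * huw + hy
  set x := u * y ^ 2 with hx
  have hx0 : x ≠ 0 := mul_ne_zero hu0 (pow_ne_zero 2 hy0)
  have hxu : x ^ 2 + 1 = u * x := by
    rw [hx]
    linear_combination (-(u * (y ^ 2 + y)) - 1) * huy + (u ^ 2 * y ^ 4 + u ^ 2 * y ^ 3 ) * h2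
  have hx1 : x + 1 ≠ 0 := by
    intro h
    refine mul_ne_zero hu0 hx0 ?_
    linear_combination -hxu + (x + 1) * h - x * h2
  set τ := z + s * w / (1 + s) with hτ
  set v := (1 + s) / w with hv
  have huv : u = v + s ^ 2 := by
    rw [hu, hv, hd]; field_simp
  have hττ : (τ ^ 2 + τ) * v ^ 2 = u := by
    have hvw : v * w = 1 + s := div_mul_cancel₀ _ hw
    have h1 : τ * v = z * v + s := by
      rw [hτ, hv]; field_simp
    have h3 : (τ ^ 2 + τ) * v ^ 2 = (τ * v) ^ 2 + (τ * v) * v := by ring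
    rw [h3, h1, huv]
    rw [hwdef] at hvw
    linear_combination v * hvw + (s * v + z * v * s) * h2
  have hB : x ^ 2 + (k + 1) * x + 1 = x * v := by
    rw [huv] at hxu
    rw [← hs]
    linear_combination hxu + s ^ 2 * x * h2
  have hquad : (x + 1) ^ 2 * x = x ^ 2 * u := by linear_combination x * hxu + x ^ 2 * h2
  set t := x * v * τ / (x + 1) with ht
  have htx : t * (x + 1) = x * v * τ := div_mul_cancel₀ _ hx1
  have hmain : (x + 1) * t ^ 2 + x * v * t + x * (x + 1) = 0 := by
    refine mul_right_cancel₀ hx1 ?_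
    linear_combination (t * (x + 1) + x * v * τ + x * v) * htx + x ^ 2 * hττ + hquad + x ^ 2 * u * h2
  refine ⟨x, t, hx0, ?_, ?_⟩
  · intro h
    rw [h] at hmain
    exact mul_ne_zero hx0 hx1 (by linear_combination hmain)
  · linear_combination hmain + t * hB - (t * k * x) * h2 + x * t * h2

theorem exists_add_eq_inv_add_eq {n : ℕ} (hn : 3 ≤ n) (heven : Even (n + 1))
    (hF : Fintype.card F = 2 ^ (n + 1)) {p r : F} (hpr : p * r ≠ 1) :
    ∃ a b c : F, a ≠ 0 ∧ b ≠ 0 ∧ c ≠ 0 ∧ a + b + c = p ∧ a⁻¹ + b⁻¹ + c⁻¹ = r := by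
  have h2 : (2 : F) = 0 := CharTwo.two_eq_zero
  have haxis (r : F) : ∃ a b c : F, a ≠ 0 ∧ b ≠ 0 ∧ c ≠ 0 ∧ a + b + c = 0 ∧
      a⁻¹ + b⁻¹ + c⁻¹ = r := by
    by_cases hr : r = 0
    · obtain ⟨z, hz⟩ := exists_sq_add_eq_of_tracePoly_eval_eq_zero hF (x := 1) (by
        rw [tracePoly_eval]
        simp only [one_pow, Finset.sum_const, Finset.card_range, nsmul_eq_mul, mul_one]
        exact (CharP.cast_eq_zero_iff F 2 _).2 heven.two_dvd)
      have hz0 : z ≠ 0 := by rintro rfl; simp at hz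
      have hz1 : z + 1 ≠ 0 := by
        intro h
        exact one_ne_zero (α := F) (by linear_combination z * h - hz)
      refine ⟨1, z, z + 1, one_ne_zero, hz0, hz1, by linear_combination (1 + z) * h2, ?_⟩
      rw [hr]
      field_simp
      linear_combination hz + (z + 1) * h2
    · classical
      obtain ⟨t, ht⟩ : ∃ t : F, t * (t + 1) * (t ^ 2 + t + 1) ≠ 0 := by
        by_contra! h
        open Polynomial in
        have hq : (X ^ 4 + X : F[X]) = 0 := by
          refine eq_zero_of_natDegree_lt_card_of_eval_eq_zero' _ Finset.univ (fun t _ => ?_) ?_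
          · rw [eval_add, eval_pow, eval_X]
            linear_combination h t - (t ^ 3 + t ^ 2) * h2
          · rw [Finset.card_univ, hF]
            have h1 : (X ^ 4 + X : F[X]).natDegree ≤ 4 := by compute_degree
            have h3 : 2 ^ 4 ≤ 2 ^ (n + 1) := Nat.pow_le_pow_right two_pos (by omega)
            omega
        simpa [Polynomial.coeff_X] using congrArg (Polynomial.coeff · 4) hq
      obtain ⟨⟨ht0, ht1⟩, ht2⟩ := by simpa only [mul_ne_zero_iff] using ht
      set a := (t ^ 2 + t + 1) / (t * (t + 1) * r) with ha
      have ha0 : a ≠ 0 := div_ne_zero ht2 (mul_ne_zero (mul_ne_zero ht0 ht1) hr)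
      refine ⟨a, t * a, (t + 1) * a, ha0, mul_ne_zero ht0 ha0, mul_ne_zero ht1 ha0,
        by linear_combination (a + t * a) * h2, ?_⟩
      have hra : a * (t * (t + 1) * r) = t ^ 2 + t + 1 :=
        div_mul_cancel₀ _ (mul_ne_zero (mul_ne_zero ht0 ht1) hr)
      clear_value a
      field_simp
      linear_combination -hra + t * h2
  by_cases hp : p = 0
  · rw [hp]
    exact haxis r
  by_cases hr : r = 0
  · obtain ⟨a, b, c, ha, hb, hc, h, h'⟩ := haxis p
    exact ⟨a⁻¹, b⁻¹, c⁻¹, inv_ne_zero ha, inv_ne_zero hb, inv_ne_zero hc, h', by simpa [hr] using h⟩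
  obtain ⟨x, y, hx, hy, hxy⟩ := exists_add_mul_eq_mul hn hF (mul_ne_zero hp hr) hpr
  have hsum : x + y + 1 ≠ 0 := by
    intro h
    rw [h, zero_mul] at hxy
    exact mul_ne_zero (mul_ne_zero hp hr) (mul_ne_zero hx hy) hxy.symm
  set e := p / (x + y + 1) with he
  have he0 : e ≠ 0 := div_ne_zero hp hsum
  have hep : e * (x + y + 1) = p := div_mul_cancel₀ _ hsum
  clear_value e
  refine ⟨e * x, e * y, e, mul_ne_zero he0 hx, mul_ne_zero he0 hy, he0,
    by linear_combination hep, ?_⟩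
  have : x * y + x + y = e * r * (x * y) := by
    refine mul_left_cancel₀ hsum ?_
    linear_combination hxy - r * (x * y) * hep
  field_simp
  linear_combination this

end Hyperbola

/-- For even `m ≥ 4` and `q = 2^m`, the hyperbola `XY = 1` is a complete Sidon set
in `𝔽_q × 𝔽_q`: it is a Sidon set and cannot be extended by any point. -/
theorem hyperbola_complete_sidon (m : ℕ) (hm : 4 ≤ m) (hmeven : Even m)
    (F : Type*) [Field F] [Fintype F] (hF : Fintype.card F = 2 ^ m)
    (H : Set (F × F)) (hH : H = {p : F × F | p.1 * p.2 = 1}) :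
    IsSidon H ∧ ∀ P : F × F, P ∉ H → ¬ IsSidon (H ∪ {P}) := by
  obtain ⟨n, rfl⟩ := Nat.exists_eq_succ_of_ne_zero (by omega : m ≠ 0)
  have : CharP F 2 := charP_of_card_eq_prime_pow hF
  subst hH
  refine ⟨isSidon_hyperbola, ?_⟩
  rintro ⟨p, r⟩ hP hS
  have hpr : p * r ≠ 1 := hP
  obtain ⟨a, b, c, ha, hb, hc, h, h'⟩ :=
    exists_add_eq_inv_add_eq (by omega) hmeven hF hpr
  have h2 : (2 : F) = 0 := CharTwo.two_eq_zero
  have hmem {x : F} (hx : x ≠ 0) : (x, x⁻¹) ∈ {p : F × F | p.1 * p.2 = 1} := mul_inv_cancel₀ hx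
  have hne {x y z : F} (hz : z ≠ 0) (h : x + y + z = p) (h' : x⁻¹ + y⁻¹ + z⁻¹ = r) : x ≠ y := by
    rintro rfl
    rw [CharTwo.add_self_eq_zero, zero_add] at h h'
    exact hpr (by rw [← h, ← h', mul_inv_cancel₀ hz])
  have hab : a ≠ b := hne hc h h'
  have hac : a ≠ c := hne hb (by linear_combination h) (by linear_combination h')
  have hbc : b ≠ c := hne ha (by linear_combination h) (by linear_combination h')
  refine hS (a, a⁻¹) (.inl (hmem ha)) (b, b⁻¹) (.inl (hmem hb)) (c, c⁻¹) (.inl (hmem hc)) (p, r)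
    (.inr rfl) (.inl ⟨fun e => hab (congrArg Prod.fst e), fun e => hac (congrArg Prod.fst e),
      fun e => hbc (congrArg Prod.fst e)⟩) ?_
  ext
  · change a + b = c + p
    linear_combination h - c * h2
  · change a⁻¹ + b⁻¹ = c⁻¹ + r
    linear_combination h' - c⁻¹ * h2
end

section
/- Let $m\geq 5$ be an odd integer, $q=2^m$, and let $\gamma\in\mathbb{F}_q$ be such that the polynomial $X^2+\gamma X+1$ is irreducible over $\mathbb{F}_q$. Let $E=\{(x,y)\in\mathbb{F}_q\times\mathbb{F}_q\mid x^2+\gamma xy+y^2=1\}$ be the canonical ellipse. Then $E$ is a complete Sidon set in the additive group $\mathbb{F}_q\times\mathbb{F}_q$: $E$ is a Sidon set, and for every point $P\in(\mathbb{F}_q\times\mathbb{F}_q)\setminus E$, the set $E\cup\{P\}$ is not a Sidon set. -/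
section EllipseSidon

variable {F : Type*} [Field F]

/-- The quadratic form defining the ellipse. -/
def ellipseForm (γ : F) (p : F × F) : F := p.1 ^ 2 + γ * p.1 * p.2 + p.2 ^ 2

/-- The points `(a, b)` viewed as `a + b ω` with `ω ^ 2 = γ ω + 1`, multiplied together. -/
def ellipseMul (γ : F) (u v : F × F) : F × F :=
  (u.1 * v.1 + u.2 * v.2, u.1 * v.2 + u.2 * v.1 + γ * u.2 * v.2)

theorem root_free_of_irreducible {γ : F}
    (hirr : Irreducible (Polynomial.X ^ 2 + Polynomial.C γ * Polynomial.X + 1 : Polynomial F))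
    (t : F) : t ^ 2 + γ * t + 1 ≠ 0 := by
  have hd : (Polynomial.X ^ 2 + Polynomial.C γ * Polynomial.X + 1 : Polynomial F).natDegree = 2 := by
    compute_degree!
  intro h
  have h1 := Polynomial.degree_eq_one_of_irreducible_of_root hirr (x := t) (by simpa using h)
  have h2 := Polynomial.natDegree_eq_of_degree_eq_some h1
  rw [hd] at h2
  norm_num at h2

theorem ellipseForm_eq_zero {γ : F} (hγ : ∀ t : F, t ^ 2 + γ * t + 1 ≠ 0) {p : F × F}
    (hp : ellipseForm γ p = 0) : p = 0 := by
  obtain ⟨a, b⟩ := p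
  simp only [ellipseForm] at hp
  by_cases hb : b = 0
  · subst hb
    have : a = 0 := by simpa using hp
    simp [this]
  · exfalso
    apply hγ (a / b)
    field_simp
    linear_combination hp

theorem ellipseForm_smul (γ l : F) (p : F × F) :
    ellipseForm γ (l • p) = l ^ 2 * ellipseForm γ p := by
  simp only [ellipseForm, Prod.smul_fst, Prod.smul_snd, smul_eq_mul]
  ring

variable [CharP F 2]

theorem ne_zero_of_root_free {γ : F} (hγ : ∀ t : F, t ^ 2 + γ * t + 1 ≠ 0) : γ ≠ 0 := by
  rintro rfl
  exact hγ 1 (by grind)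

theorem ellipseForm_mul (γ : F) (u v : F × F) :
    ellipseForm γ (ellipseMul γ u v) = ellipseForm γ u * ellipseForm γ v := by
  simp only [ellipseForm, ellipseMul]
  grind

theorem isSidon_ellipse {γ : F} (hγ : ∀ t : F, t ^ 2 + γ * t + 1 ≠ 0) :
    IsSidon {p : F × F | ellipseForm γ p = 1} := by
  intro x hx y hy z hz w hw hd hsum
  have hγ0 := ne_zero_of_root_free hγ
  have two (a : F × F) : a + a = 0 := by
    ext <;> exact CharTwo.add_self_eq_zero _
  have hxy : x ≠ y := by
    rintro rfl
    have : z = w := by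
      rw [two] at hsum
      have := two w
      grind
    unfold ThreeDistinct at hd
    grind
  have hxz : x ≠ z := by
    rintro rfl
    have : y = w := by simpa using hsum
    unfold ThreeDistinct at hd
    grind
  have hyz : y ≠ z := by
    rintro rfl
    have : x = w := by rw [add_comm] at hsum; simpa using hsum
    unfold ThreeDistinct at hd
    grind
  have hs0 : x + y ≠ 0 := by
    intro h
    have := two y
    apply hxy
    grind
  have hs : ellipseForm γ (x + y) ≠ 0 := fun h => hs0 (ellipseForm_eq_zero hγ h)
  have hw' : w = x + y + z := by
    have := two z
    grind
  subst hw'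
  have hcross : (x.1 + z.1) * (x.2 + y.2) = (x.2 + z.2) * (x.1 + y.1) := by
    apply mul_left_cancel₀ hγ0
    simp only [Set.mem_ofPred_eq, ellipseForm, Prod.fst_add, Prod.snd_add] at hx hy hz hw
    grind
  obtain ⟨l, hl⟩ : ∃ l : F, z = x + l • (x + y) := by
    by_cases h1 : x.1 + y.1 = 0
    · have h2 : x.2 + y.2 ≠ 0 := fun h => hs0 (Prod.ext h1 h)
      refine ⟨(x.2 + z.2) / (x.2 + y.2), Prod.ext ?_ ?_⟩ <;>
      simp only [Prod.fst_add, Prod.snd_add, Prod.smul_fst, Prod.smul_snd, smul_eq_mul] <;>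
      grind
    · refine ⟨(x.1 + z.1) / (x.1 + y.1), Prod.ext ?_ ?_⟩ <;>
      simp only [Prod.fst_add, Prod.snd_add, Prod.smul_fst, Prod.smul_snd, smul_eq_mul] <;>
      grind
  have hl2 : ellipseForm γ (x + y) * (l * (l + 1)) = 0 := by
    rw [hl] at hz
    simp only [Set.mem_ofPred_eq, ellipseForm, Prod.fst_add, Prod.snd_add, Prod.smul_fst,
      Prod.smul_snd, smul_eq_mul] at hx hy hz ⊢
    grind
  rcases mul_eq_zero.1 ((mul_eq_zero.1 hl2).resolve_left hs) with h | h
  · exact hxz (by simp [hl, h])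
  · have h1 : l = 1 := by grind
    apply hyz
    rw [hl, h1, one_smul, ← add_assoc, two, zero_add]

theorem exists_ellipse_pair {γ : F} {s : F × F} {b : F × F} (hb : ellipseForm γ b = 1)
    (hs : ellipseForm γ s = γ * b.2) (hb0 : γ * b.2 ≠ 0) :
    ∃ x : F × F, ellipseForm γ x = 1 ∧ ellipseForm γ (x + s) = 1 := by
  set d := γ * b.2 with hd
  have hq : ellipseForm γ (1 + b.1 + γ * b.2, b.2) = d := by
    simp only [ellipseForm] at hb ⊢
    grind
  refine ⟨d⁻¹ • ellipseMul γ s (1 + b.1 + γ * b.2, b.2), ?_, ?_⟩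
  · rw [ellipseForm_smul, ellipseForm_mul, hs, hq]
    field_simp
  · have : d⁻¹ • ellipseMul γ s (1 + b.1 + γ * b.2, b.2) + s =
        d⁻¹ • ellipseMul γ (ellipseMul γ s (1 + b.1 + γ * b.2, b.2)) b := by
      have h1 : s = d⁻¹ • d • s := by rw [smul_smul, inv_mul_cancel₀ hb0, one_smul]
      conv_lhs => rhs; rw [h1]
      rw [← smul_add]
      congr 1
      simp only [ellipseForm] at hb
      ext <;> simp only [ellipseMul, Prod.fst_add, Prod.snd_add, Prod.smul_fst, Prod.smul_snd,
        smul_eq_mul] <;> grind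
    rw [this, ellipseForm_smul, ellipseForm_mul, ellipseForm_mul, hs, hq, hb]
    field_simp

/-- Each `γ ^ 2 / (t ^ 2 + γ t + 1)` is `γ b` for a point `(a, b)` of the ellipse. -/
theorem exists_ellipse_point {γ : F} (hγ : ∀ t : F, t ^ 2 + γ * t + 1 ≠ 0) (t : F) :
    ∃ b : F × F, ellipseForm γ b = 1 ∧ γ * b.2 = γ ^ 2 / (t ^ 2 + γ * t + 1) := by
  have h := hγ t
  refine ⟨(1 + t * γ / (t ^ 2 + γ * t + 1), γ / (t ^ 2 + γ * t + 1)), ?_, ?_⟩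
  · simp only [ellipseForm]
    field_simp
    grind
  · field_simp

theorem not_isSidon_of_add_eq {γ : F} {P x s z : F × F} (hP : ellipseForm γ P ≠ 1)
    (hx : ellipseForm γ x = 1) (hxs : ellipseForm γ (x + s) = 1) (hz : ellipseForm γ z = 1)
    (hs : s ≠ 0) (h : s + z = P) :
    ¬ IsSidon ({p : F × F | ellipseForm γ p = 1} ∪ {P}) := by
  intro hS
  have two (a : F × F) : a + a = 0 := by
    ext <;> exact CharTwo.add_self_eq_zero _
  have h1 : x ≠ z := by
    rintro rfl
    exact hP (by rw [← h, add_comm, hxs])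
  have h2 : x + s ≠ z := by
    rintro rfl
    have : P = x := by
      rw [← h, add_comm x s, ← add_assoc, two, zero_add]
    exact hP (this ▸ hx)
  refine hS x (Or.inl hx) (x + s) (Or.inl hxs) z (Or.inl hz) P (Or.inr rfl)
    (Or.inl ⟨by simpa using hs, h1, h2⟩) ?_
  rw [← h, ← add_assoc, two, zero_add, add_comm s z, ← add_assoc, two, zero_add]

variable [Fintype F]

theorem card_le_two_mul_card_image [DecidableEq F] {γ : F}
    (hγ : ∀ t : F, t ^ 2 + γ * t + 1 ≠ 0) :
    Fintype.card F ≤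
      2 * (Finset.univ.image fun t : F => γ ^ 2 / (t ^ 2 + γ * t + 1)).card := by
  have hγ0 := ne_zero_of_root_free hγ
  rw [← Finset.card_univ]
  refine Finset.card_le_mul_card_image _ 2 fun d hd => ?_
  obtain ⟨t, -, rfl⟩ := Finset.mem_image.1 hd
  refine (Finset.card_le_card (t := {t, t + γ}) fun u hu => ?_).trans Finset.card_le_two
  have h := (Finset.mem_filter.1 hu).2
  have h1 := hγ t
  have h2 := hγ u
  field_simp at h
  have h3 : (u + t) * (u + t + γ) = 0 := by grind
  simp only [Finset.mem_insert, Finset.mem_singleton]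
  rcases mul_eq_zero.1 h3 with h | h <;> grind

theorem exists_ellipse_points_of_ne {γ r : F} (hγ : ∀ t : F, t ^ 2 + γ * t + 1 ≠ 0)
    (hr0 : r ≠ 0) (hr1 : r ≠ 1) :
    ∃ w b : F × F, ellipseForm γ w = 1 ∧ ellipseForm γ b = 1 ∧ γ * b.2 ≠ 0 ∧
      r ^ 2 + 1 + r * (γ * w.2) = γ * b.2 := by
  classical
  have hγ0 := ne_zero_of_root_free hγ
  set D := Finset.univ.image fun t : F => γ ^ 2 / (t ^ 2 + γ * t + 1) with hD
  have hcard : Fintype.card F ≤ 2 * D.card := card_le_two_mul_card_image hγ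
  have hpt : ∀ d ∈ D, d ≠ 0 ∧ ∃ b : F × F, ellipseForm γ b = 1 ∧ γ * b.2 = d := by
    intro d hd
    obtain ⟨t, -, rfl⟩ := Finset.mem_image.1 hd
    exact ⟨div_ne_zero (pow_ne_zero _ hγ0) (hγ t), exists_ellipse_point hγ t⟩
  have h0 : (0 : F) ∉ D := fun h => (hpt 0 h).1 rfl
  have hpt' : ∀ c ∈ insert 0 D, ∃ w : F × F, ellipseForm γ w = 1 ∧ γ * w.2 = c := by
    intro c hc
    rcases Finset.mem_insert.1 hc with rfl | hc
    · exact ⟨(1, 0), by simp [ellipseForm], by simp⟩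
    · exact (hpt c hc).2
  set D' := (insert 0 D).image fun c => r ^ 2 + 1 + r * c with hD'
  have hD'card : D'.card = D.card + 1 := by
    rw [hD', Finset.card_image_of_injective, Finset.card_insert_of_notMem h0]
    intro c c' h
    simpa [hr0] using h
  have hD'0 : (0 : F) ∉ D' := by
    intro h
    obtain ⟨c, hc, h⟩ := Finset.mem_image.1 h
    obtain ⟨w, hw, rfl⟩ := hpt' c hc
    have : ellipseForm γ (r + w.1, w.2) = 0 := by
      simp only [ellipseForm] at hw ⊢
      grind
    have := ellipseForm_eq_zero hγ this
    simp only [Prod.mk_eq_zero] at this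
    simp only [ellipseForm] at hw
    have h3 : (r + 1) * (r + 1) = 0 := by grind
    have := mul_self_eq_zero.1 h3
    grind
  have hmeet : ¬ Disjoint D' D := by
    intro hdis
    have h1 : (D' ∪ D).card ≤ (Finset.univ.erase (0 : F)).card :=
      Finset.card_le_card fun d hd => Finset.mem_erase.2
        ⟨fun h => (Finset.mem_union.1 (h ▸ hd)).elim hD'0 h0, Finset.mem_univ _⟩
    rw [Finset.card_union_of_disjoint hdis, Finset.card_erase_of_mem (Finset.mem_univ _),
      Finset.card_univ] at h1
    omega
  obtain ⟨d, hd', hd⟩ := Finset.not_disjoint_iff.1 hmeet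
  obtain ⟨c, hc, hcd⟩ := Finset.mem_image.1 hd'
  obtain ⟨w, hw, rfl⟩ := hpt' c hc
  obtain ⟨hd0, b, hb, rfl⟩ := hpt d hd
  exact ⟨w, b, hw, hb, hd0, hcd⟩

theorem sq_add_self_ne_one {m : ℕ} (hm : Odd m) (hF : Fintype.card F = 2 ^ m) (v : F) :
    v ^ 2 + v ≠ 1 := by
  intro h
  have h3 : v ^ 3 = 1 := by grind
  have hv1 : v ≠ 1 := by
    rintro rfl
    grind
  have hv0 : v ≠ 0 := by
    rintro rfl
    simp at h
  have ho : orderOf v = 3 := orderOf_eq_prime h3 hv1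
  have hdvd : 3 ∣ 2 ^ m - 1 := by
    rw [← ho, ← hF]
    exact orderOf_dvd_of_pow_eq_one (FiniteField.pow_card_sub_one_eq_one v hv0)
  obtain ⟨k, rfl⟩ := hm
  have h4 : 2 ^ (2 * k + 1) % 3 = 2 := by
    rw [pow_succ, pow_mul, Nat.mul_mod, Nat.pow_mod]
    norm_num
  generalize 2 ^ (2 * k + 1) = n at h4 hdvd
  omega

/-- The additive map `v ↦ v ^ 2 + v` in characteristic two. -/
def artinSchreierHom (F : Type*) [Field F] [CharP F 2] : F →+ F where
  toFun v := v ^ 2 + v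
  map_zero' := by simp
  map_add' a b := by grind

theorem index_range_artinSchreierHom : (artinSchreierHom F).range.index = 2 := by
  have hker : ((artinSchreierHom F).ker : Set F) = {0, 1} := by
    ext v
    simp only [SetLike.mem_coe, AddMonoidHom.mem_ker, Set.mem_insert_iff, Set.mem_singleton_iff]
    change v ^ 2 + v = 0 ↔ _
    constructor
    · intro h
      have : v * (v + 1) = 0 := by grind
      rcases mul_eq_zero.1 this with h | h <;> grind
    · rintro (rfl | rfl) <;> grind
  have hk : Nat.card (artinSchreierHom F).ker = 2 := by
    change Nat.card ((artinSchreierHom F).ker : Set F) = 2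
    rw [hker, Nat.card_coe_set_eq, Set.ncard_pair zero_ne_one]
  have h1 := (artinSchreierHom F).ker.card_mul_index
  rw [AddSubgroup.index_ker, hk] at h1
  have h2 := (artinSchreierHom F).range.card_mul_index
  have h3 : 0 < Nat.card (artinSchreierHom F).range := Nat.card_pos
  rw [← h1, mul_comm 2] at h2
  exact Nat.eq_of_mul_eq_mul_left h3 h2

theorem exists_ellipse_point_snd_eq_one {γ : F} (hγ : ∀ t : F, t ^ 2 + γ * t + 1 ≠ 0)
    (h1 : ∀ v : F, v ^ 2 + v ≠ 1) : ∃ b : F × F, ellipseForm γ b = 1 ∧ γ * b.2 = 1 := by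
  have hγ0 := ne_zero_of_root_free hγ
  have hone : (1 : F) ∉ (artinSchreierHom F).range := fun ⟨v, hv⟩ => h1 v hv
  have hinv : (γ⁻¹ ^ 2 : F) ∉ (artinSchreierHom F).range := by
    rintro ⟨v, hv⟩
    change v ^ 2 + v = _ at hv
    apply hγ (γ * v)
    field_simp at hv
    grind
  obtain ⟨v, hv⟩ : 1 + γ⁻¹ ^ 2 ∈ (artinSchreierHom F).range := by
    rw [AddSubgroup.add_mem_iff_of_index_two index_range_artinSchreierHom]
    exact iff_of_false hone hinv
  change v ^ 2 + v = _ at hv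
  refine ⟨(v, γ⁻¹), ?_, mul_inv_cancel₀ hγ0⟩
  simp only [ellipseForm]
  grind

end EllipseSidon

/-- For odd `m ≥ 5`, `q = 2^m`, and `γ ∈ 𝔽_q` with `X² + γX + 1` irreducible over `𝔽_q`,
the ellipse `X² + γXY + Y² = 1` is a complete Sidon set in `𝔽_q × 𝔽_q`. -/
theorem ellipse_complete_sidon (m : ℕ) (hm : 5 ≤ m) (hmodd : Odd m)
    (F : Type*) [Field F] [Fintype F] (hF : Fintype.card F = 2 ^ m)
    (γ : F)
    (hirr : Irreducible (Polynomial.X ^ 2 + Polynomial.C γ * Polynomial.X + 1 : Polynomial F))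
    (E : Set (F × F)) (hE : E = {p : F × F | p.1 ^ 2 + γ * p.1 * p.2 + p.2 ^ 2 = 1}) :
    IsSidon E ∧ ∀ P : F × F, P ∉ E → ¬ IsSidon (E ∪ {P}) := by
  have hchar : CharP F 2 := charP_of_card_eq_prime_pow hF
  have hγ := root_free_of_irreducible hirr
  change E = {p : F × F | ellipseForm γ p = 1} at hE
  subst hE
  refine ⟨isSidon_ellipse hγ, fun P hP => ?_⟩
  change ellipseForm γ P ≠ 1 at hP
  by_cases hP0 : P = 0
  · obtain ⟨b, hb, hb1⟩ := exists_ellipse_point_snd_eq_one hγ (sq_add_self_ne_one hmodd hF)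
    have hs : ellipseForm γ ((1, 0) : F × F) = 1 := by simp [ellipseForm]
    obtain ⟨x, hx, hxs⟩ := exists_ellipse_pair hb (hs.trans hb1.symm) (by simp [hb1])
    refine not_isSidon_of_add_eq hP hx hxs hs (by simp) ?_
    rw [hP0]
    ext <;> exact CharTwo.add_self_eq_zero _
  · obtain ⟨r, hr⟩ := FiniteField.isSquare_of_char_two (ringChar.eq F 2) (ellipseForm γ P)
    have hr0 : r ≠ 0 := by
      rintro rfl
      exact hP0 (ellipseForm_eq_zero hγ (by simpa using hr))
    have hr1 : r ≠ 1 := by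
      rintro rfl
      exact hP (by simpa using hr)
    obtain ⟨w, b, hw, hb, hb0, hwb⟩ := exists_ellipse_points_of_ne hγ hr0 hr1
    set u := r⁻¹ • P with hu
    have hPu : P = r • u := by rw [hu, smul_smul, mul_inv_cancel₀ hr0, one_smul]
    have hu1 : ellipseForm γ u = 1 := by
      rw [hu, ellipseForm_smul, hr]
      field_simp
    have hz : ellipseForm γ (ellipseMul γ u w) = 1 := by rw [ellipseForm_mul, hu1, hw, one_mul]
    have hs : ellipseForm γ (P + ellipseMul γ u w) = γ * b.2 := by
      have : P + ellipseMul γ u w = ellipseMul γ u (r + w.1, w.2) := by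
        rw [hPu]
        ext <;> simp only [ellipseMul, Prod.fst_add, Prod.snd_add, Prod.smul_fst, Prod.smul_snd,
          smul_eq_mul] <;> ring
      rw [this, ellipseForm_mul, hu1, one_mul, ← hwb]
      simp only [ellipseForm] at hw ⊢
      grind
    obtain ⟨x, hx, hxs⟩ := exists_ellipse_pair hb hs hb0
    refine not_isSidon_of_add_eq hP hx hxs hz ?_ ?_
    · intro h
      rw [h] at hs
      exact hb0 (by rw [← hs]; simp [ellipseForm])
    · rw [add_assoc]
      conv_rhs => rw [← add_zero P]
      congr 1
      ext <;> exact CharTwo.add_self_eq_zero _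
end

section
/- Let $m\geq 5$ be an odd integer and $q=2^m$. Let $H=\{(x,y)\in\mathbb{F}_q\times\mathbb{F}_q\mid xy=1\}$ be the canonical hyperbola, whose nucleus is the origin $N=(0,0)$. Then $H\cup\{N\}$ is a complete Sidon set in the additive group $\mathbb{F}_q\times\mathbb{F}_q$: $H\cup\{N\}$ is a Sidon set, and for every point $P\in(\mathbb{F}_q\times\mathbb{F}_q)\setminus(H\cup\{N\})$, the set $H\cup\{N\}\cup\{P\}$ is not a Sidon set. -/
section ArtinSchreier

variable (F : Type*) [Field F] [CharP F 2]

/-- The Artin–Schreier map `r ↦ r ^ 2 + r` in characteristic two. -/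
def artinSchreier : F →+ F where
  toFun r := r ^ 2 + r
  map_zero' := by simp
  map_add' r s := by rw [CharTwo.add_sq]; ring

theorem mem_range_artinSchreier {x : F} : x ∈ (artinSchreier F).range ↔ ∃ r, r ^ 2 + r = x :=
  Iff.rfl

theorem card_ker_artinSchreier : Nat.card (artinSchreier F).ker = 2 := by
  have h : ((artinSchreier F).ker : Set F) = {0, 1} := by
    ext r
    have h2 : (2 : F) = 0 := CharTwo.two_eq_zero
    change r ^ 2 + r = 0 ↔ r = 0 ∨ r = 1
    constructor
    · intro h
      have : r * (r - 1) = 0 := by linear_combination h - r * h2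
      rcases mul_eq_zero.1 this with h | h
      · exact Or.inl h
      · exact Or.inr (sub_eq_zero.1 h)
    · rintro (rfl | rfl)
      · simp
      · linear_combination h2
  change Nat.card ((artinSchreier F).ker : Set F) = 2
  rw [h, Nat.card_coe_set_eq, Set.ncard_pair zero_ne_one]

theorem index_range_artinSchreier [Finite F] : (artinSchreier F).range.index = 2 := by
  have h1 := (artinSchreier F).ker.card_mul_index
  have h2 := (artinSchreier F).range.card_mul_index
  rw [AddSubgroup.index_ker, card_ker_artinSchreier] at h1
  have h3 : 0 < Nat.card (artinSchreier F).range := Nat.card_pos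
  rw [← h1, mul_comm] at h2
  exact Nat.eq_of_mul_eq_mul_right h3 h2

open Classical in
/-- The sign character of `F` with kernel the range of the Artin–Schreier map. -/
noncomputable def artinSchreierSign (x : F) : ℤ :=
  if x ∈ (artinSchreier F).range then 1 else -1

variable {F}

theorem artinSchreierSign_of_mem {x : F} (hx : x ∈ (artinSchreier F).range) :
    artinSchreierSign F x = 1 := if_pos hx

theorem artinSchreierSign_of_notMem {x : F} (hx : x ∉ (artinSchreier F).range) :
    artinSchreierSign F x = -1 := if_neg hx

theorem artinSchreierSign_le_one (x : F) : artinSchreierSign F x ≤ 1 := by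
  unfold artinSchreierSign; split_ifs <;> norm_num

theorem artinSchreierSign_sq (x : F) : artinSchreierSign F x ^ 2 = 1 := by
  unfold artinSchreierSign; split_ifs <;> norm_num

theorem artinSchreierSign_zero : artinSchreierSign F 0 = 1 :=
  artinSchreierSign_of_mem (zero_mem _)

theorem artinSchreierSign_add [Finite F] (x y : F) :
    artinSchreierSign F (x + y) = artinSchreierSign F x * artinSchreierSign F y := by
  have h := AddSubgroup.add_mem_iff_of_index_two (index_range_artinSchreier F) (a := x) (b := y)
  unfold artinSchreierSign
  split_ifs <;> simp_all

theorem artinSchreierSign_pow_two [Finite F] (x : F) :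
    artinSchreierSign F (x ^ 2) = artinSchreierSign F x := by
  have h : artinSchreierSign F (x ^ 2 + x) = 1 := artinSchreierSign_of_mem ⟨x, rfl⟩
  rw [artinSchreierSign_add] at h
  linear_combination artinSchreierSign F x * h -
    artinSchreierSign F (x ^ 2) * artinSchreierSign_sq x

theorem exists_notMem_range_artinSchreier [Finite F] : ∃ x : F, x ∉ (artinSchreier F).range := by
  by_contra! h
  have h2 := index_range_artinSchreier F
  rw [(AddSubgroup.eq_top_iff' _).2 h, AddSubgroup.index_top] at h2
  norm_num at h2

/-- Inversion is almost perfect nonlinear when the Artin–Schreier map omits `1`. -/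
theorem eq_or_eq_of_add_eq_add_of_inv_add_inv_eq (h1 : (1 : F) ∉ (artinSchreier F).range)
    {x y z w : F} (h : x + y = z + w) (h' : x⁻¹ + y⁻¹ = z⁻¹ + w⁻¹) :
    x = y ∨ x = z ∨ x = w := by
  have h2 : (2 : F) = 0 := CharTwo.two_eq_zero
  have of_zero {y z w : F} (h : y = z + w) (h' : y⁻¹ = z⁻¹ + w⁻¹) : y = 0 ∨ z = 0 ∨ w = 0 := by
    by_contra! hne
    obtain ⟨hy, hz, hw⟩ := hne
    refine h1 ⟨z / w, ?_⟩
    change (z / w) ^ 2 + z / w = 1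
    field_simp at h' ⊢
    grind
  by_cases hx : x = 0
  · have := @of_zero y z w (by simpa [hx] using h) (by simpa [hx] using h')
    grind
  by_cases hy : y = 0
  · have := @of_zero x z w (by simpa [hy] using h) (by simpa [hy] using h')
    grind
  by_cases hz : z = 0
  · have := @of_zero w x y (by simpa [hz] using h.symm) (by simpa [hz] using h'.symm)
    grind
  by_cases hw : w = 0
  · have := @of_zero z x y (by simpa [hw] using h.symm) (by simpa [hw] using h'.symm)
    grind
  by_contra! hne
  obtain ⟨hxy, hxz, hxw⟩ := hne
  have hs : x + y ≠ 0 := by rwa [Ne, CharTwo.add_eq_zero]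
  field_simp at h'
  have hp : (x + y) * (x * y) = (x + y) * (z * w) := by grind
  have hp' := mul_left_cancel₀ hs hp
  have : (x - z) * (x - w) = 0 := by linear_combination x * h - hp'
  rcases mul_eq_zero.1 this with h | h
  · exact hxz (sub_eq_zero.1 h)
  · exact hxw (sub_eq_zero.1 h)

variable [Fintype F]

theorem sum_artinSchreierSign : ∑ x : F, artinSchreierSign F x = 0 := by
  obtain ⟨x₀, h₀⟩ := exists_notMem_range_artinSchreier (F := F)
  have h := Equiv.sum_comp (Equiv.addRight x₀) (artinSchreierSign F)
  simp only [Equiv.coe_addRight, artinSchreierSign_add, artinSchreierSign_of_notMem h₀,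
    mul_neg, mul_one, Finset.sum_neg_distrib] at h
  linarith

theorem sum_artinSchreierSign_mul {a : F} (ha : a ≠ 0) :
    ∑ x : F, artinSchreierSign F (x * a) = 0 :=
  (Equiv.sum_comp (Equiv.mulRight₀ a ha) (artinSchreierSign F)).trans sum_artinSchreierSign

theorem one_notMem_range_artinSchreier {m : ℕ} (hm : Odd m) (hF : Fintype.card F = 2 ^ m) :
    (1 : F) ∉ (artinSchreier F).range := by
  rintro ⟨r, hr⟩
  change r ^ 2 + r = 1 at hr
  have h2 : (2 : F) = 0 := CharTwo.two_eq_zero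
  have h4 : r ^ 4 = r := by linear_combination (r ^ 2 - r + 2) * hr + (1 - 2 * r) * h2
  obtain ⟨k, rfl⟩ := hm
  have h4k (k : ℕ) : r ^ 4 ^ k = r := by
    induction k with
    | zero => simp
    | succ k ih => rw [pow_succ, pow_mul, ih, h4]
  have hcard := FiniteField.pow_card r
  rw [hF, pow_succ, pow_mul, pow_mul, show (2 : ℕ) ^ 2 = 4 by norm_num, h4k] at hcard
  exact one_ne_zero (by linear_combination -hr + hcard + r * h2 : (1 : F) = 0)

section Kloosterman

variable [DecidableEq F]

/-- The binary Kloosterman sum over `F`. -/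
noncomputable def kloostermanSum (t : F) : ℤ :=
  ∑ w : Fˣ, artinSchreierSign F (w + t * (w : F)⁻¹)

theorem kloostermanSum_zero : kloostermanSum (0 : F) = -1 := by
  have h := sum_artinSchreierSign (F := F)
  rw [Fintype.sum_eq_add_sum_subtype_ne _ (0 : F), artinSchreierSign_zero,
    ← Equiv.sum_comp unitsEquivNeZero] at h
  simp only [kloostermanSum, zero_mul, add_zero]
  simp only [unitsEquivNeZero_apply_coe] at h
  linarith

theorem kloostermanSum_pow_two (t : F) : kloostermanSum (t ^ 2) = kloostermanSum t := by
  have hinj : Function.Injective fun w : Fˣ => w ^ 2 := fun u v h => by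
    refine Units.ext (CharTwo.sq_injective ?_)
    simpa using congrArg Units.val h
  unfold kloostermanSum
  rw [← (Equiv.ofBijective _ (Finite.injective_iff_bijective.1 hinj)).sum_comp]
  refine Finset.sum_congr rfl fun w _ => ?_
  rw [← artinSchreierSign_pow_two ((w : F) + t * (w : F)⁻¹), CharTwo.add_sq]
  simp [mul_pow]

theorem sum_kloostermanSum_sq :
    ∑ t : F, kloostermanSum t ^ 2 = Fintype.card F * (Fintype.card F - 1 : ℤ) := by
  have key (w v : Fˣ) : ∑ t : F, artinSchreierSign F (w + t * (w : F)⁻¹) *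
      artinSchreierSign F (v + t * (v : F)⁻¹) = if w = v then (Fintype.card F : ℤ) else 0 := by
    split_ifs with h
    · subst h
      simp [← sq, artinSchreierSign_sq]
    · have h0 : (w : F)⁻¹ + (v : F)⁻¹ ≠ 0 := by
        rw [Ne, CharTwo.add_eq_zero, inv_inj, Units.val_inj]
        exact h
      have (t : F) : artinSchreierSign F (w + t * (w : F)⁻¹) *
          artinSchreierSign F (v + t * (v : F)⁻¹) =
          artinSchreierSign F (w + v) * artinSchreierSign F (t * ((w : F)⁻¹ + (v : F)⁻¹)) := by
        rw [← artinSchreierSign_add, ← artinSchreierSign_add]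
        congr 1
        ring
      simp only [this, ← Finset.mul_sum, sum_artinSchreierSign_mul h0, mul_zero]
  simp only [kloostermanSum, sq, Finset.sum_mul_sum]
  rw [Finset.sum_comm]
  simp only [Finset.sum_comm (s := (Finset.univ : Finset F)), key]
  have h1 : 1 ≤ Fintype.card F := Fintype.card_pos
  simp [Fintype.card_units, Nat.cast_sub h1, mul_comm]

theorem two_mul_kloostermanSum_sq_le {t : F} (h0 : t ≠ 0) (h1 : t ≠ 1) :
    2 * kloostermanSum t ^ 2 ≤ Fintype.card F * (Fintype.card F - 1 : ℤ) := by
  have hne : t ≠ t ^ 2 := fun h => h1 (mul_left_cancel₀ h0 (by rw [mul_one, ← sq, ← h]))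
  rw [← sum_kloostermanSum_sq]
  calc 2 * kloostermanSum t ^ 2 = ∑ s ∈ {t, t ^ 2}, kloostermanSum s ^ 2 := by
        rw [Finset.sum_pair hne, kloostermanSum_pow_two, two_mul]
    _ ≤ _ := Finset.sum_le_sum_of_subset_of_nonneg (Finset.subset_univ _)
        fun _ _ _ => sq_nonneg _

/-- An affine change of variables turns the twisted sum into a Kloosterman sum. -/
theorem sum_artinSchreierSign_mul_add {d c e : F} (hd : d ≠ 0) :
    ∑ w : Fˣ, artinSchreierSign F (d * w + d * c * (w : F)⁻¹ + e) =
      artinSchreierSign F e * kloostermanSum (d ^ 2 * c) := by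
  rw [kloostermanSum, ← Equiv.sum_comp (Equiv.mulLeft (Units.mk0 d hd))
    (fun w : Fˣ => artinSchreierSign F (w + d ^ 2 * c * (w : F)⁻¹)), Finset.mul_sum]
  refine Finset.sum_congr rfl fun w _ => ?_
  rw [artinSchreierSign_add, mul_comm]
  congr 2
  simp only [Equiv.coe_mulLeft, Units.val_mul, Units.val_mk0, mul_inv]
  have := w.ne_zero
  field_simp

end Kloosterman

theorem exists_mem_range_artinSchreier {m : ℕ} (hm5 : 5 ≤ m) (hm : Odd m)
    (hF : Fintype.card F = 2 ^ m) {c : F} (hc : c ≠ 1) :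
    ∃ w : F, w ≠ 0 ∧ w ≠ 1 ∧ w ≠ c ∧
      (w + 1) * (w + c) / (w * (1 + c) ^ 2) ∈ (artinSchreier F).range := by
  classical
  by_contra! hcon
  have h2 : (2 : F) = 0 := CharTwo.two_eq_zero
  have he : 1 + c ≠ 0 := fun h => hc (by linear_combination h - h2)
  set e := 1 + c with he'
  have hc' : c = e + 1 := by linear_combination -he' - h2
  have hd : (e ^ 2)⁻¹ ≠ 0 := inv_ne_zero (pow_ne_zero 2 he)
  have hsum := sum_artinSchreierSign_mul_add (c := c) (e := e⁻¹) hd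
  have hterm (w : Fˣ) : (e ^ 2)⁻¹ * (w : F) + (e ^ 2)⁻¹ * c * (w : F)⁻¹ + e⁻¹ =
      ((w : F) + 1) * (w + c) / (w * e ^ 2) := by
    have := w.ne_zero
    field_simp
    rw [he']
    ring
  simp only [hterm] at hsum
  have hle (w : Fˣ) : artinSchreierSign F (((w : F) + 1) * (w + c) / (w * e ^ 2)) ≤
      -1 + (if (w : F) = 1 then 2 else 0) + (if (w : F) = c then 2 else 0) := by
    have := artinSchreierSign_le_one (((w : F) + 1) * (w + c) / (w * e ^ 2))
    by_cases h1 : (w : F) = 1 <;> by_cases hwc : (w : F) = c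
    · rw [if_pos h1, if_pos hwc]; linarith
    · rw [if_pos h1, if_neg hwc]; linarith
    · rw [if_neg h1, if_pos hwc]; linarith
    · rw [if_neg h1, if_neg hwc]
      rw [artinSchreierSign_of_notMem (hcon w w.ne_zero h1 hwc)]
      norm_num
  have hind (a : F) : ∑ w : Fˣ, (if (w : F) = a then 2 else 0 : ℤ) ≤ 2 := by
    rw [← Finset.sum_filter, Finset.sum_const]
    have : (Finset.univ.filter fun w : Fˣ => (w : F) = a).card ≤ 1 :=
      Finset.card_le_one.2 fun u hu v hv => Units.ext <|
        (Finset.mem_filter.1 hu).2.trans (Finset.mem_filter.1 hv).2.symm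
    rw [nsmul_eq_mul]
    have : ((Finset.univ.filter fun w : Fˣ => (w : F) = a).card : ℤ) ≤ 1 := by exact_mod_cast this
    linarith
  have htot := Finset.sum_le_sum fun w (_ : w ∈ (Finset.univ : Finset Fˣ)) => hle w
  have hcardpos : 1 ≤ Fintype.card F := Fintype.card_pos
  rw [hsum, Finset.sum_add_distrib, Finset.sum_add_distrib, Finset.sum_const, Finset.card_univ,
    Fintype.card_units, nsmul_eq_mul, Nat.cast_sub hcardpos] at htot
  have hq : (32 : ℤ) ≤ Fintype.card F := by
    rw [hF]
    exact_mod_cast Nat.pow_le_pow_right (n := 2) (by norm_num) hm5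
  have hi1 := hind 1
  have hic := hind c
  set K := kloostermanSum ((e ^ 2)⁻¹ ^ 2 * c) with hK
  have hbound : artinSchreierSign F e⁻¹ * K ≤ -(Fintype.card F - 5 : ℤ) := by
    push_cast at htot
    linarith
  have hsq : (Fintype.card F - 5 : ℤ) ^ 2 ≤ K ^ 2 := by
    have : (artinSchreierSign F e⁻¹ * K) ^ 2 = K ^ 2 := by
      rw [mul_pow, artinSchreierSign_sq, one_mul]
    rw [← this]
    nlinarith
  by_cases h0 : c = 0
  · rw [hK, h0, mul_zero, kloostermanSum_zero] at hsq
    nlinarith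
  · have ht1 : (e ^ 2)⁻¹ ^ 2 * c ≠ 1 := by
      intro h
      have h4 : c = e ^ 4 := by
        field_simp at h
        linear_combination h
      apply one_notMem_range_artinSchreier hm hF
      refine ⟨e ^ 2 + e, ?_⟩
      change (e ^ 2 + e) ^ 2 + (e ^ 2 + e) = 1
      linear_combination -h4 + hc' + (e ^ 3 + e ^ 2 + e) * h2
    have := two_mul_kloostermanSum_sq_le (mul_ne_zero (pow_ne_zero 2 hd) h0) ht1
    nlinarith

theorem exists_sum_eq_one_sum_inv_eq {m : ℕ} (hm5 : 5 ≤ m) (hm : Odd m)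
    (hF : Fintype.card F = 2 ^ m) {c : F} (hc : c ≠ 1) :
    ∃ x y z : F, x + y + z = 1 ∧ x⁻¹ + y⁻¹ + z⁻¹ = c := by
  obtain ⟨w, hw0, hw1, hwc, r, hr⟩ := exists_mem_range_artinSchreier hm5 hm hF hc
  change r ^ 2 + r = _ at hr
  have h2 : (2 : F) = 0 := CharTwo.two_eq_zero
  have he : 1 + c ≠ 0 := by rwa [Ne, CharTwo.add_eq_zero, eq_comm]
  have h1 : w + 1 ≠ 0 := by rwa [Ne, CharTwo.add_eq_zero]
  have h3 : w + c ≠ 0 := by rwa [Ne, CharTwo.add_eq_zero]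
  have hr0 : r * (r + 1) ≠ 0 := by
    rw [show r * (r + 1) = r ^ 2 + r by ring, hr]
    positivity
  obtain ⟨hr1, hr2⟩ := mul_ne_zero_iff.1 hr0
  rw [eq_div_iff (by positivity)] at hr
  refine ⟨(1 + c) / (w + c) * r, (1 + c) / (w + c) * (r + 1), (1 + w) / (w + c), ?_, ?_⟩
  · field_simp
    grind
  · have h1' : 1 + w ≠ 0 := by rwa [add_comm]
    have hxy : ((1 + c) / (w + c) * r)⁻¹ + ((1 + c) / (w + c) * (r + 1))⁻¹ =
        (w + c) / ((1 + c) * (r ^ 2 + r)) := by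
      have : r ^ 2 + r ≠ 0 := by rwa [show r ^ 2 + r = r * (r + 1) by ring]
      field_simp
      grind
    have hrr : r ^ 2 + r = (w + 1) * (w + c) / (w * (1 + c) ^ 2) := by
      rw [eq_div_iff (by positivity), hr]
    rw [hxy, hrr]
    field_simp
    grind

theorem exists_sum_eq_sum_inv_eq {m : ℕ} (hm5 : 5 ≤ m) (hm : Odd m)
    (hF : Fintype.card F = 2 ^ m) {a b : F} (hab : b ≠ a⁻¹) :
    ∃ x y z : F, x + y + z = a ∧ x⁻¹ + y⁻¹ + z⁻¹ = b := by
  have of_ne_zero {a b : F} (ha : a ≠ 0) (hab : b ≠ a⁻¹) :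
      ∃ x y z : F, x + y + z = a ∧ x⁻¹ + y⁻¹ + z⁻¹ = b := by
    have hc : a * b ≠ 1 := fun h => hab (eq_inv_of_mul_eq_one_right h)
    obtain ⟨x, y, z, h, h'⟩ := exists_sum_eq_one_sum_inv_eq hm5 hm hF hc
    refine ⟨a * x, a * y, a * z, by rw [← mul_add, ← mul_add, h, mul_one], ?_⟩
    rw [mul_inv, mul_inv, mul_inv, ← mul_add, ← mul_add, h', inv_mul_cancel_left₀ ha]
  by_cases ha : a = 0
  · subst ha
    rw [inv_zero] at hab
    obtain ⟨x, y, z, h, h'⟩ := of_ne_zero hab (inv_ne_zero hab).symm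
    exact ⟨x⁻¹, y⁻¹, z⁻¹, by simpa using h', by simpa using h⟩
  · exact of_ne_zero ha hab

end ArtinSchreier

theorem hyperbola_union_nucleus_eq {F : Type*} [Field F] :
    {p : F × F | p.1 * p.2 = 1} ∪ {(0, 0)} = {p : F × F | p.2 = p.1⁻¹} := by
  ext ⟨x, y⟩
  simp only [Set.mem_union, Set.mem_ofPred_eq, Set.mem_singleton_iff, Prod.mk.injEq]
  by_cases hx : x = 0
  · simp [hx]
  · simp [hx, mul_comm x y, mul_eq_one_iff_eq_inv₀]

/-- For odd `m ≥ 5` and `q = 2^m`, the hyperbola `XY = 1` together with its nucleus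
`N = (0,0)` is a complete Sidon set in `𝔽_q × 𝔽_q`. -/
theorem hyperbola_with_nucleus_complete_sidon (m : ℕ) (hm : 5 ≤ m) (hmodd : Odd m)
    (F : Type*) [Field F] [Fintype F] (hF : Fintype.card F = 2 ^ m)
    (H : Set (F × F)) (hH : H = {p : F × F | p.1 * p.2 = 1})
    (N : F × F) (hN : N = (0, 0)) :
    IsSidon (H ∪ {N}) ∧ ∀ P : F × F, P ∉ H ∪ {N} → ¬ IsSidon (H ∪ {N} ∪ {P}) := by
  have : Fact (Nat.Prime 2) := ⟨Nat.prime_two⟩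
  have : CharP F 2 := charP_of_card_eq_prime_pow hF
  have h2 : (2 : F) = 0 := CharTwo.two_eq_zero
  subst hH hN
  rw [hyperbola_union_nucleus_eq]
  constructor
  · rintro ⟨x, x'⟩ hx ⟨y, y'⟩ hy ⟨z, z'⟩ hz ⟨w, w'⟩ hw hd h
    obtain rfl : x' = x⁻¹ := hx
    obtain rfl : y' = y⁻¹ := hy
    obtain rfl : z' = z⁻¹ := hz
    obtain rfl : w' = w⁻¹ := hw
    obtain ⟨h, h'⟩ := Prod.mk.inj h
    simp only at h h' hd
    simp only [ThreeDistinct] at hd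
    rcases eq_or_eq_of_add_eq_add_of_inv_add_inv_eq
      (one_notMem_range_artinSchreier hmodd hF) h h' with rfl | rfl | rfl
    · have : z = w := by grind
      subst this
      simp at hd
    · have : y = w := by grind
      subst this
      simp at hd
    · have : y = z := by grind
      subst this
      simp at hd
  · rintro ⟨a, b⟩ hP hS
    change b ≠ a⁻¹ at hP
    obtain ⟨x, y, z, h, h'⟩ := exists_sum_eq_sum_inv_eq hm hmodd hF hP
    refine hS (x, x⁻¹) (Or.inl rfl) (y, y⁻¹) (Or.inl rfl) (z, z⁻¹) (Or.inl rfl) (a, b)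
      (Or.inr rfl) (Or.inl ?_) (Prod.ext ?_ ?_)
    · refine ⟨?_, ?_, ?_⟩ <;> intro hxy <;> obtain ⟨rfl, -⟩ := Prod.mk.inj hxy <;> grind
    · change x + y = z + a
      grind
    · change x⁻¹ + y⁻¹ = z⁻¹ + b
      grind
end

section
/- Let $n$ be a positive integer such that every Sidon set $S\subseteq\mathbb{F}_2^n$ satisfies $|S|\leq 2^{n/2}+2$ (as an inequality of real numbers). Then every APN function $f:\mathbb{F}_2^n\to\mathbb{F}_2^n$ satisfies $\mathrm{NL}_{v}(f)\geq 2^n-2^{n/2}-2$, i.e., for every affine map $\alpha:\mathbb{F}_2^n\to\mathbb{F}_2^n$ one has $|\{x\mid f(x)\neq\alpha(x)\}|\geq 2^n-2^{n/2}-2$. -/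
/-- If every element of `A` is its own negative, then an additive relation `x + y = z + w` among
elements of which three are pairwise different forces `x`, `y`, `z` to be pairwise different. -/
theorem ThreeDistinct.pairwise_ne_of_add_eq_add {A : Type*} [AddCommGroup A]
    (h2 : ∀ v : A, v + v = 0) {x y z w : A} (hd : ThreeDistinct x y z w) (h : x + y = z + w) :
    x ≠ y ∧ x ≠ z ∧ y ≠ z := by
  have key : ∀ u v : A, u + v = 0 → u = v := fun u v huv =>
    add_right_cancel (huv.trans (h2 v).symm)
  unfold ThreeDistinct at hd
  refine ⟨?_, ?_, ?_⟩ <;> rintro rfl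
  · have hzw := key z w (by rw [← h, h2])
    grind
  · have hyw := add_left_cancel h
    grind
  · have hxw : x = w := add_right_cancel (h.trans (add_comm _ _))
    grind

/-- Between groups in which every element is its own negative, an APN function agrees with
an affine map on a Sidon set. -/
theorem isSidon_agreement_of_apn {A B : Type*} [AddCommGroup A] [Finite A] [AddCommGroup B]
    (hA : ∀ v : A, v + v = 0) (hB : ∀ v : B, v + v = 0) {f α : A → B}
    (hAPN : ∀ a : A, a ≠ 0 → ∀ b : B, {x : A | f x + f (x + a) = b}.ncard ≤ 2)
    (hα : ∀ x y z, α (x + y + z) = α x + α y + α z) :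
    IsSidon {x | f x = α x} := by
  intro x hx y hy z hz w hw hd h
  obtain ⟨hxy, hxz, hyz⟩ := hd.pairwise_ne_of_add_eq_add hA h
  have ha : x + y ≠ 0 := fun h0 => hxy (add_right_cancel (h0.trans (hA y).symm))
  have hxa : x + (x + y) = y := by rw [← add_assoc, hA, zero_add]
  have hya : y + (x + y) = x := by rw [add_left_comm, hA, add_zero]
  have hza : z + (x + y) = w := by rw [h, ← add_assoc, hA, zero_add]
  have hαw : α w = α x + α y + α z := by rw [← hα, ← hza, add_comm z]
  have hsub : ({x, y, z} : Set A) ⊆ {u | f u + f (u + (x + y)) = α x + α y} := by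
    simp only [Set.mem_ofPred_eq] at hx hy hz hw
    rintro u (rfl | rfl | rfl) <;> simp only [Set.mem_ofPred_eq]
    · rw [hxa, hx, hy]
    · rw [hya, hx, hy, add_comm]
    · rw [hza, hz, hw, hαw, add_left_comm, hB, add_zero]
  have hcard := Set.ncard_le_ncard hsub (Set.toFinite _)
  rw [Set.ncard_eq_three.mpr ⟨x, y, z, hxy, hxz, hyz, rfl⟩] at hcard
  have := hAPN _ ha (α x + α y)
  omega

/-- If every Sidon set in `𝔽₂ⁿ` has size at most `2^(n/2) + 2`, then every APN function
`f : 𝔽₂ⁿ → 𝔽₂ⁿ` has vectorial nonlinearity at least `2^n - 2^(n/2) - 2`, i.e. every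
affine map `α` differs from `f` in at least `2^n - 2^(n/2) - 2` points. -/
theorem apn_nonlinearity_of_sidon_bound (n : ℕ) (hn : 0 < n)
    (hSidon : ∀ S : Set (Fin n → ZMod 2),
      IsSidon S → (S.ncard : ℝ) ≤ (2 : ℝ) ^ ((n : ℝ) / 2) + 2)
    (f : (Fin n → ZMod 2) → (Fin n → ZMod 2))
    (hAPN : ∀ a : Fin n → ZMod 2, a ≠ 0 → ∀ b : Fin n → ZMod 2,
      {x : Fin n → ZMod 2 | f x + f (x + a) = b}.ncard ≤ 2)
    (α : (Fin n → ZMod 2) → (Fin n → ZMod 2))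
    (hα : ∀ x y z, α (x + y + z) = α x + α y + α z) :
    (2 : ℝ) ^ n - (2 : ℝ) ^ ((n : ℝ) / 2) - 2 ≤
      ({x : Fin n → ZMod 2 | f x ≠ α x}.ncard : ℝ) := by
  have h2 : ∀ v : Fin n → ZMod 2, v + v = 0 := fun v => funext fun _ =>
    CharTwo.add_self_eq_zero _
  have hS := hSidon _ (isSidon_agreement_of_apn h2 h2 hAPN hα)
  have hsum : {x | f x = α x}.ncard + {x | f x ≠ α x}.ncard = 2 ^ n := by
    have h := Set.ncard_add_ncard_compl {x | f x = α x}
    simpa [Set.compl_ofPred, Nat.card_eq_fintype_card] using h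
  have hsum' : ({x | f x = α x}.ncard : ℝ) + {x | f x ≠ α x}.ncard = 2 ^ n := by
    exact_mod_cast hsum
  linarith
end

section
/- Let $q=2^m$ for a positive integer $m$, and let $H=\{(x,y)\in\mathbb{F}_q\times\mathbb{F}_q\mid xy=1\}$ be the canonical hyperbola. Then $H$ is a Sidon set in the additive group $\mathbb{F}_q\times\mathbb{F}_q$. -/
/-- A point of the hyperbola `XY = 1` is determined by its first coordinate. -/
theorem eq_of_fst_eq_of_mul_eq_one {F : Type*} [Field F] {p q : F × F}
    (hp : p.1 * p.2 = 1) (hq : q.1 * q.2 = 1) (h : p.1 = q.1) : p = q :=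
  Prod.ext h <| by
    rw [h] at hp
    exact mul_left_cancel₀ (left_ne_zero_of_mul_eq_one hq) (hp.trans hq.symm)

/-- Over any field, two pairs of points of the hyperbola `XY = 1` with the same sum agree up to
order, unless the first coordinates of each pair cancel. -/
theorem add_fst_eq_zero_or_eq_or_eq_of_add_eq_add {F : Type*} [Field F] {x y z w : F × F}
    (hx : x.1 * x.2 = 1) (hy : y.1 * y.2 = 1) (hz : z.1 * z.2 = 1) (hw : w.1 * w.2 = 1)
    (h : x + y = z + w) : x.1 + y.1 = 0 ∨ x = z ∨ x = w := by
  have h₁ : x.1 + y.1 = z.1 + w.1 := congrArg Prod.fst h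
  have h₂ : x.2 + y.2 = z.2 + w.2 := congrArg Prod.snd h
  have hxy : x.1 * y.1 * (x.2 + y.2) = x.1 + y.1 := by
    linear_combination y.1 * hx + x.1 * hy
  have hzw : z.1 * w.1 * (z.2 + w.2) = z.1 + w.1 := by
    linear_combination w.1 * hz + z.1 * hw
  refine or_iff_not_imp_left.2 fun hs => ?_
  have hne : x.2 + y.2 ≠ 0 := fun h₀ => hs (by rw [← hxy, h₀, mul_zero])
  have hprod : x.1 * y.1 = z.1 * w.1 :=
    mul_right_cancel₀ hne (by rw [hxy, h₂, hzw, h₁])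
  have hroots : (x.1 - z.1) * (x.1 - w.1) = 0 := by
    linear_combination x.1 * h₁ - hprod
  exact (mul_eq_zero.1 hroots).imp
    (fun h₀ => eq_of_fst_eq_of_mul_eq_one hx hz (sub_eq_zero.1 h₀))
    (fun h₀ => eq_of_fst_eq_of_mul_eq_one hx hw (sub_eq_zero.1 h₀))

/-- For `q = 2^m`, the hyperbola `XY = 1` is a Sidon set in `𝔽_q × 𝔽_q`. -/
theorem hyperbola_sidon (m : ℕ) (hm : 0 < m)
    (F : Type*) [Field F] [Fintype F] (hF : Fintype.card F = 2 ^ m)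
    (H : Set (F × F)) (hH : H = {p : F × F | p.1 * p.2 = 1}) :
    IsSidon H := by
  subst hH
  have : CharP F 2 := charP_of_card_eq_prime_pow hF
  intro x hx y hy z hz w hw hd h
  rw [Set.mem_ofPred_eq] at hx hy hz hw
  rcases add_fst_eq_zero_or_eq_or_eq_of_add_eq_add hx hy hz hw h with hs | rfl | rfl
  · obtain rfl := eq_of_fst_eq_of_mul_eq_one hx hy (CharTwo.add_eq_zero.1 hs)
    have hs' : z.1 + w.1 = 0 := (congrArg Prod.fst h).symm.trans hs
    obtain rfl := eq_of_fst_eq_of_mul_eq_one hz hw (CharTwo.add_eq_zero.1 hs')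
    simp [ThreeDistinct] at hd
  · obtain rfl := add_left_cancel h
    grind [ThreeDistinct]
  · obtain rfl := add_left_cancel (h.trans (add_comm _ _))
    grind [ThreeDistinct]
end

section
/- Let $q=2^m$ for a positive integer $m$, and let $\gamma\in\mathbb{F}_q$ be such that $X^2+\gamma X+1$ is irreducible over $\mathbb{F}_q$. Let $E=\{(x,y)\in\mathbb{F}_q\times\mathbb{F}_q\mid x^2+\gamma xy+y^2=1\}$ be the canonical ellipse. Then $E$ is a Sidon set in the additive group $\mathbb{F}_q\times\mathbb{F}_q$. -/
/-- A field whose cardinality is a power of two satisfies `2 = 0`. -/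
theorem two_eq_zero_of_card_eq_two_pow {F : Type*} [Field F] [Fintype F] {m : ℕ}
    (hF : Fintype.card F = 2 ^ m) : (2 : F) = 0 := by
  have h : ((Fintype.card F : ℕ) : F) = 0 := Nat.cast_card_eq_zero F
  rw [hF, Nat.cast_pow, Nat.cast_ofNat] at h
  exact eq_zero_of_pow_eq_zero h

open Polynomial in
/-- If `X² + γX + 1` is irreducible, it has no root. -/
theorem quadratic_ne_zero_of_irreducible {F : Type*} [Field F] {γ : F}
    (hirr : Irreducible (X ^ 2 + C γ * X + 1 : F[X])) (t : F) : t ^ 2 + γ * t + 1 ≠ 0 := by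
  intro ht
  have hdeg : (X ^ 2 + C γ * X + 1 : F[X]).natDegree = 2 := by compute_degree!
  have hroot : IsRoot (X ^ 2 + C γ * X + 1 : F[X]) t := by simpa [IsRoot] using ht
  have hdeg' := natDegree_eq_of_degree_eq_some (n := 1)
    (degree_eq_one_of_irreducible_of_root hirr hroot)
  omega

/-- If `X² + γX + 1` has no root, the form `a² + γab + b²` is anisotropic. -/
theorem ellipse_form_anisotropic {F : Type*} [Field F] {γ : F}
    (hγ : ∀ t : F, t ^ 2 + γ * t + 1 ≠ 0) {a b : F} (h : a ^ 2 + γ * a * b + b ^ 2 = 0) :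
    a = 0 ∧ b = 0 := by
  have hb : b = 0 := by
    by_contra hb
    refine hγ (a / b) ?_
    field_simp
    linear_combination h
  subst hb
  simpa using h

/-- A vector with vanishing determinant against a nonzero `(c, d)` is a multiple of `(c, d)`. -/
theorem exists_eq_mul_of_mul_eq_mul {F : Type*} [Field F] {a b c d : F}
    (hs : ¬(c = 0 ∧ d = 0)) (h : a * d = b * c) : ∃ t, a = t * c ∧ b = t * d := by
  by_cases hc : c = 0
  · have hd : d ≠ 0 := fun hd => hs ⟨hc, hd⟩
    refine ⟨b / d, ?_, by field_simp⟩
    field_simp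
    exact h
  · refine ⟨a / c, by field_simp, ?_⟩
    field_simp
    exact h.symm

/-- For `q = 2^m` and `γ ∈ 𝔽_q` with `X² + γX + 1` irreducible over `𝔽_q`, the ellipse
`X² + γXY + Y² = 1` is a Sidon set in `𝔽_q × 𝔽_q`. -/
theorem ellipse_sidon (m : ℕ) (hm : 0 < m)
    (F : Type*) [Field F] [Fintype F] (hF : Fintype.card F = 2 ^ m)
    (γ : F)
    (hirr : Irreducible (Polynomial.X ^ 2 + Polynomial.C γ * Polynomial.X + 1 : Polynomial F))
    (E : Set (F × F)) (hE : E = {p : F × F | p.1 ^ 2 + γ * p.1 * p.2 + p.2 ^ 2 = 1}) :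
    IsSidon E := by
  have h2 := two_eq_zero_of_card_eq_two_pow hF
  have hroot := quadratic_ne_zero_of_irreducible hirr
  have hγ : γ ≠ 0 := fun h => hroot 1 (by linear_combination h + h2)
  subst hE
  rintro ⟨x₁, x₂⟩ hx ⟨y₁, y₂⟩ hy ⟨z₁, z₂⟩ hz ⟨w₁, w₂⟩ hw hdist hsum
  simp only [Set.mem_ofPred_eq] at hx hy hz hw
  simp only [Prod.mk_add_mk, Prod.mk.injEq] at hsum
  obtain ⟨hs₁, hs₂⟩ := hsum
  obtain rfl : w₁ = x₁ + y₁ + z₁ := by linear_combination -hs₁ - z₁ * h2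
  obtain rfl : w₂ = x₂ + y₂ + z₂ := by linear_combination -hs₂ - z₂ * h2
  by_cases hxy : x₁ + y₁ = 0 ∧ x₂ + y₂ = 0
  · obtain ⟨h₁, h₂⟩ := hxy
    obtain rfl : y₁ = x₁ := by linear_combination h₁ - x₁ * h2
    obtain rfl : y₂ = x₂ := by linear_combination h₂ - x₂ * h2
    simp [ThreeDistinct, h₁, h₂] at hdist
  have hdet : (x₁ + z₁) * (x₂ + y₂) = (x₂ + z₂) * (x₁ + y₁) := by
    apply mul_left_cancel₀ hγ
    grind
  obtain ⟨t, ht₁, ht₂⟩ := exists_eq_mul_of_mul_eq_mul hxy hdet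
  have hQ : t * (t + 1) * ((x₁ + y₁) ^ 2 + γ * (x₁ + y₁) * (x₂ + y₂) + (x₂ + y₂) ^ 2) = 0 := by
    obtain rfl : z₁ = x₁ + t * (x₁ + y₁) := by linear_combination ht₁ - x₁ * h2
    obtain rfl : z₂ = x₂ + t * (x₂ + y₂) := by linear_combination ht₂ - x₂ * h2
    grind
  rcases mul_eq_zero.mp hQ with ht | h
  · rcases mul_eq_zero.mp ht with rfl | ht
    · obtain rfl : z₁ = x₁ := by linear_combination ht₁ - x₁ * h2
      obtain rfl : z₂ = x₂ := by linear_combination ht₂ - x₂ * h2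
      have h₁ : z₁ + y₁ + z₁ = y₁ := by linear_combination z₁ * h2
      have h₂ : z₂ + y₂ + z₂ = y₂ := by linear_combination z₂ * h2
      rw [h₁, h₂] at hdist
      unfold ThreeDistinct at hdist
      tauto
    · obtain rfl : z₁ = y₁ := by linear_combination ht₁ + (x₁ + y₁) * ht - (x₁ + y₁) * h2
      obtain rfl : z₂ = y₂ := by linear_combination ht₂ + (x₂ + y₂) * ht - (x₂ + y₂) * h2
      have h₁ : x₁ + z₁ + z₁ = x₁ := by linear_combination z₁ * h2
      have h₂ : x₂ + z₂ + z₂ = x₂ := by linear_combination z₂ * h2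
      rw [h₁, h₂] at hdist
      unfold ThreeDistinct at hdist
      tauto
  · exact hxy (ellipse_form_anisotropic hroot h)
end

section
/- Let $q=2^m$ for a positive integer $m$, and let $H=\{(x,y)\in\mathbb{F}_q\times\mathbb{F}_q\mid xy=1\}$ be the canonical hyperbola, with nucleus $N=(0,0)$. Then $H\cup\{N\}$ is a Sidon set in the additive group $\mathbb{F}_q\times\mathbb{F}_q$ if and only if $3$ does not divide $q-1$ (equivalently, if and only if $m$ is odd). -/
section InverseGraph

variable {F : Type*} [Field F]

theorem hyperbola_union_origin_eq_graph_inv :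
    {p : F × F | p.1 * p.2 = 1} ∪ {(0, 0)} = {p : F × F | p.2 = p.1⁻¹} := by
  ext ⟨a, b⟩
  simp only [Set.mem_union, Set.mem_ofPred_eq, Set.mem_singleton_iff, Prod.mk.injEq]
  constructor
  · rintro (h | ⟨rfl, rfl⟩)
    · exact (inv_eq_of_mul_eq_one_right h).symm
    · simp
  · rintro rfl
    by_cases h : a = 0
    · simp [h]
    · exact Or.inl (mul_inv_cancel₀ h)

theorem three_dvd_card_sub_one_iff_exists_root [Fintype F] (h2 : (2 : F) = 0) :
    3 ∣ Fintype.card F - 1 ↔ ∃ t : F, t ^ 2 + t + 1 = 0 := by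
  classical
  have : Fact (Nat.Prime 3) := ⟨Nat.prime_three⟩
  rw [← Fintype.card_units]
  constructor
  · intro h
    obtain ⟨u, hu⟩ := exists_prime_orderOf_dvd_card 3 h
    have h3 : (u : F) ^ 3 = 1 := by
      rw [← Units.val_pow_eq_pow_val, ← hu, pow_orderOf_eq_one, Units.val_one]
    have h1 : (u : F) - 1 ≠ 0 := by
      intro h
      have : u = 1 := Units.ext (sub_eq_zero.mp h)
      simp [this] at hu
    refine ⟨u, mul_left_cancel₀ h1 ?_⟩
    linear_combination h3
  · rintro ⟨t, ht⟩
    have h0 : t ≠ 0 := by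
      rintro rfl
      simp at ht
    have h3 : t ^ 3 = 1 := by linear_combination (t - 1) * ht
    have h1 : t ≠ 1 := by
      rintro rfl
      exact one_ne_zero (α := F) (by linear_combination ht - h2)
    have hu : orderOf (Units.mk0 t h0) = 3 := by
      apply orderOf_eq_prime
      · ext
        simpa using h3
      · intro h
        exact h1 (by simpa using congrArg Units.val h)
    exact hu ▸ orderOf_dvd_card

theorem exists_root_of_add_eq_of_inv_add_inv_eq {a b c : F}
    (ha : a ≠ 0) (hb : b ≠ 0) (hc : c ≠ 0) (h : a = b + c)
    (hinv : a⁻¹ = b⁻¹ + c⁻¹) : ∃ t : F, t ^ 2 + t + 1 = 0 := by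
  refine ⟨b / c, ?_⟩
  field_simp at hinv ⊢
  subst h
  linear_combination -hinv

theorem exists_root_of_add_eq_add_of_inv_add_inv_eq (h2 : (2 : F) = 0) {a b c d : F}
    (hab : a ≠ b) (hac : a ≠ c) (had : a ≠ d) (h : a + b = c + d)
    (hinv : a⁻¹ + b⁻¹ = c⁻¹ + d⁻¹) : ∃ t : F, t ^ 2 + t + 1 = 0 := by
  have hneg (x : F) : -x = x := by linear_combination -x * h2
  have hbc : b ≠ c := fun e => had (by linear_combination h - e)
  have hbd : b ≠ d := fun e => hac (by linear_combination h - e)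
  have hcd : c ≠ d := fun e => hab (by linear_combination h + e + (d - b) * h2)
  by_cases ha : a = 0
  · subst ha
    exact exists_root_of_add_eq_of_inv_add_inv_eq hab.symm hac.symm had.symm
      (by simpa using h) (by simpa using hinv)
  by_cases hb : b = 0
  · subst hb
    exact exists_root_of_add_eq_of_inv_add_inv_eq ha hbc.symm hbd.symm
      (by simpa using h) (by simpa using hinv)
  by_cases hc : c = 0
  · subst hc
    exact exists_root_of_add_eq_of_inv_add_inv_eq hcd.symm ha hb
      (by simpa using h.symm) (by simpa using hinv.symm)
  by_cases hd : d = 0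
  · subst hd
    exact exists_root_of_add_eq_of_inv_add_inv_eq hc ha hb
      (by simpa using h.symm) (by simpa using hinv.symm)
  exfalso
  have hs : a + b ≠ 0 := fun e => hab (by linear_combination e - b * h2)
  have hprod : a * b = c * d := by
    field_simp at hinv
    refine mul_left_cancel₀ hs ?_
    linear_combination a * b * h - hinv
  have : (a - c) * (a - d) = 0 := by linear_combination -hprod + a * h
  rcases mul_eq_zero.mp this with e | e
  · exact hac (sub_eq_zero.mp e)
  · exact had (sub_eq_zero.mp e)

theorem isSidon_graph_inv_iff (h2 : (2 : F) = 0) :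
    IsSidon {p : F × F | p.2 = p.1⁻¹} ↔ ¬ ∃ t : F, t ^ 2 + t + 1 = 0 := by
  constructor
  · rintro hS ⟨t, ht⟩
    have h0 : t ≠ 0 := by
      rintro rfl
      simp at ht
    have h1 : t ≠ 1 := by
      rintro rfl
      exact one_ne_zero (α := F) (by linear_combination ht - h2)
    have hinv : t⁻¹ = t + 1 :=
      inv_eq_of_mul_eq_one_right (by linear_combination ht - h2)
    have hinv' : (t + 1)⁻¹ = t := by rw [← hinv, inv_inv]
    refine hS (0, 0) (by simp) (t + 1, t) hinv'.symm (1, 1) (by simp) (t, t + 1) hinv.symm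
      (Or.inr (Or.inr (Or.inl ⟨?_, ?_, ?_⟩))) ?_
    · simp
    · simp [h0.symm]
    · simp [h1.symm]
    · ext
      · simp [add_comm]
      · simp only [Prod.snd_add]
        linear_combination -h2
  · rintro hroot ⟨a, a'⟩ ha ⟨b, b'⟩ hb ⟨c, c'⟩ hc ⟨d, d'⟩ hd hdist hsum
    simp only [Set.mem_ofPred_eq] at ha hb hc hd
    subst ha hb hc hd
    simp only [Prod.mk_add_mk, Prod.mk.injEq] at hsum
    obtain ⟨h, hinv⟩ := hsum
    refine hroot (exists_root_of_add_eq_add_of_inv_add_inv_eq h2 ?_ ?_ ?_ h hinv)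
    · rintro rfl
      have : c = d := by linear_combination -h + (a - d) * h2
      simp [ThreeDistinct, this] at hdist
    · rintro rfl
      have : b = d := by linear_combination h
      simp [ThreeDistinct, this] at hdist
    · rintro rfl
      have : b = c := by linear_combination h
      simp [ThreeDistinct, this] at hdist

end InverseGraph

/-- For `q = 2^m`, the hyperbola `XY = 1` together with its nucleus `N = (0,0)` is a
Sidon set in `𝔽_q × 𝔽_q` if and only if `3` does not divide `|H| = q - 1`. -/
theorem hyperbola_with_nucleus_sidon_iff (m : ℕ) (hm : 0 < m)
    (F : Type*) [Field F] [Fintype F] (hF : Fintype.card F = 2 ^ m)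
    (H : Set (F × F)) (hH : H = {p : F × F | p.1 * p.2 = 1})
    (N : F × F) (hN : N = (0, 0)) :
    IsSidon (H ∪ {N}) ↔ ¬ (3 ∣ 2 ^ m - 1) := by
  subst hH hN
  have h2 : (2 : F) = 0 := by
    have h := FiniteField.cast_card_eq_zero F
    rw [hF, Nat.cast_pow] at h
    exact_mod_cast eq_zero_of_pow_eq_zero h
  rw [hyperbola_union_origin_eq_graph_inv, isSidon_graph_inv_iff h2, ← hF,
    three_dvd_card_sub_one_iff_exists_root h2]
end

section
/- Let $q=2^m$ for a positive integer $m$, and let $\gamma\in\mathbb{F}_q$ be such that $X^2+\gamma X+1$ is irreducible over $\mathbb{F}_q$. Let $E=\{(x,y)\in\mathbb{F}_q\times\mathbb{F}_q\mid x^2+\gamma xy+y^2=1\}$ be the canonical ellipse, with nucleus $N=(0,0)$. Then $E\cup\{N\}$ is a Sidon set in the additive group $\mathbb{F}_q\times\mathbb{F}_q$ if and only if $3$ does not divide $q+1$ (equivalently, if and only if $m$ is even). -/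
/-- The additive map `t ↦ t ^ 2 + t` of a commutative ring of characteristic two. -/
def artinSchreierTwo (F : Type*) [CommRing F] [CharP F 2] : F →+ F where
  toFun t := t ^ 2 + t
  map_zero' := by ring
  map_add' a b := by grind

theorem artinSchreierTwo_apply {F : Type*} [CommRing F] [CharP F 2] (t : F) :
    artinSchreierTwo F t = t ^ 2 + t := rfl

/-- The image of `t ↦ t ^ 2 + t` has index two in a finite field of characteristic two. -/
theorem index_range_artinSchreierTwo (F : Type*) [Field F] [Finite F] [CharP F 2] :
    (artinSchreierTwo F).range.index = 2 := by
  have hker : Nat.card (artinSchreierTwo F).ker = 2 := by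
    have h : ((artinSchreierTwo F).ker : Set F) = {0, 1} := by
      ext t
      simp only [SetLike.mem_coe, AddMonoidHom.mem_ker, artinSchreierTwo_apply,
        Set.mem_insert_iff, Set.mem_singleton_iff]
      constructor
      · intro h
        have : t * (t - 1) = 0 := by grind
        rcases mul_eq_zero.mp this with h | h
        · exact Or.inl h
        · exact Or.inr (sub_eq_zero.mp h)
      · rintro (rfl | rfl) <;> grind
    change Nat.card ((artinSchreierTwo F).ker : Set F) = 2
    rw [h, Nat.card_coe_set_eq, Set.ncard_pair zero_ne_one]
  have h₁ := (artinSchreierTwo F).ker.card_mul_index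
  have h₂ := (artinSchreierTwo F).range.card_mul_index
  rw [AddSubgroup.index_ker, hker, ← h₂, mul_comm] at h₁
  exact (Nat.eq_of_mul_eq_mul_left Nat.card_pos h₁).symm

/-- A finite field of characteristic two contains a root of `X ^ 2 + X + 1` if and only if
`3` divides the order of its multiplicative group. -/
theorem exists_sq_add_self_eq_one_iff (F : Type*) [Field F] [Fintype F] [CharP F 2] :
    (∃ t : F, t ^ 2 + t = 1) ↔ 3 ∣ Fintype.card F - 1 := by
  classical
  rw [← Fintype.card_units]
  have : Fact (Nat.Prime 3) := ⟨Nat.prime_three⟩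
  constructor
  · rintro ⟨t, ht⟩
    have ht0 : t ≠ 0 := by rintro rfl; simp at ht
    have h3 : t ^ 3 = 1 := by grind
    have h1 : t ≠ 1 := by rintro rfl; grind
    have : orderOf (Units.mk0 t ht0) = 3 := by
      apply orderOf_eq_prime
      · ext; simpa using h3
      · intro h; exact h1 (by simpa using congrArg Units.val h)
    rw [← this]
    exact orderOf_dvd_card
  · intro h
    obtain ⟨u, hu⟩ := exists_prime_orderOf_dvd_card 3 h
    have h3 : (u : F) ^ 3 = 1 := by
      have := pow_orderOf_eq_one u
      rw [hu] at this
      simpa using congrArg Units.val this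
    have h1 : (u : F) ≠ 1 := by
      intro h
      have : u = 1 := Units.ext h
      rw [this, orderOf_one] at hu
      omega
    refine ⟨u, ?_⟩
    have : ((u : F) - 1) * ((u : F) ^ 2 + u + 1) = 0 := by linear_combination h3
    have := (mul_eq_zero.mp this).resolve_left (sub_ne_zero.mpr h1)
    grind

/-- The form `x ^ 2 + γ x y + y ^ 2` is anisotropic if `X ^ 2 + γ X + 1` has no root. -/
theorem eq_zero_of_sq_add_mul_add_sq_eq_zero {F : Type*} [Field F] {γ : F}
    (hγ : ∀ t : F, t ^ 2 + γ * t + 1 ≠ 0) {x y : F} (h : x ^ 2 + γ * x * y + y ^ 2 = 0) :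
    x = 0 ∧ y = 0 := by
  have hy : y = 0 := by
    by_contra hy
    apply hγ (x / y)
    field_simp
    linear_combination h
  subst hy
  simpa using h

/-- If two points of the ellipse have sum `s ≠ 0`, they are the only such pair. -/
theorem eq_or_eq_of_add_eq_add_of_mem_ellipse {F : Type*} [Field F] [CharP F 2] {γ : F}
    (hγ0 : γ ≠ 0) (hγ : ∀ t : F, t ^ 2 + γ * t + 1 ≠ 0) {a₁ a₂ b₁ b₂ c₁ c₂ d₁ d₂ : F}
    (ha : a₁ ^ 2 + γ * a₁ * a₂ + a₂ ^ 2 = 1) (hb : b₁ ^ 2 + γ * b₁ * b₂ + b₂ ^ 2 = 1)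
    (hc : c₁ ^ 2 + γ * c₁ * c₂ + c₂ ^ 2 = 1) (hd : d₁ ^ 2 + γ * d₁ * d₂ + d₂ ^ 2 = 1)
    (h₁ : a₁ + b₁ = c₁ + d₁) (h₂ : a₂ + b₂ = c₂ + d₂) (hab : ¬(a₁ = b₁ ∧ a₂ = b₂)) :
    (c₁ = a₁ ∧ c₂ = a₂) ∨ (c₁ = b₁ ∧ c₂ = b₂) := by
  obtain ⟨s₁, rfl⟩ : ∃ s₁, b₁ = a₁ + s₁ := ⟨b₁ - a₁, by ring⟩
  obtain ⟨s₂, rfl⟩ : ∃ s₂, b₂ = a₂ + s₂ := ⟨b₂ - a₂, by ring⟩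
  have hd₁ : d₁ = c₁ + s₁ := by grind
  have hd₂ : d₂ = c₂ + s₂ := by grind
  subst hd₁ hd₂
  have hs : s₁ ^ 2 + γ * s₁ * s₂ + s₂ ^ 2 ≠ 0 := by
    intro h
    obtain ⟨rfl, rfl⟩ := eq_zero_of_sq_add_mul_add_sq_eq_zero hγ h
    simp at hab
  have hpar : (a₁ + c₁) * s₂ = (a₂ + c₂) * s₁ := by
    apply mul_left_cancel₀ hγ0
    grind
  obtain ⟨l, hl₁, hl₂⟩ : ∃ l, c₁ = a₁ + l * s₁ ∧ c₂ = a₂ + l * s₂ := by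
    by_cases h0 : s₁ = 0
    · have h0' : s₂ ≠ 0 := by rintro rfl; simp [h0] at hs
      refine ⟨(a₂ + c₂) / s₂, ?_, ?_⟩ <;> field_simp <;> grind
    · refine ⟨(a₁ + c₁) / s₁, ?_, ?_⟩ <;> field_simp <;> grind
  subst hl₁ hl₂
  have hl : l * (l - 1) * (s₁ ^ 2 + γ * s₁ * s₂ + s₂ ^ 2) = 0 := by grind
  rcases mul_eq_zero.mp ((mul_eq_zero.mp hl).resolve_right hs) with h | h
  · left; simp [h]
  · right; simp [sub_eq_zero.mp h]

/-- Three points of the ellipse sum to zero only if `γ⁻² + 1` has the form `t ^ 2 + t`. -/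
theorem exists_of_add_mem_ellipse {F : Type*} [Field F] [CharP F 2] {γ : F}
    (hγ0 : γ ≠ 0) {a₁ a₂ b₁ b₂ : F}
    (ha : a₁ ^ 2 + γ * a₁ * a₂ + a₂ ^ 2 = 1) (hb : b₁ ^ 2 + γ * b₁ * b₂ + b₂ ^ 2 = 1)
    (hc : (a₁ + b₁) ^ 2 + γ * (a₁ + b₁) * (a₂ + b₂) + (a₂ + b₂) ^ 2 = 1) :
    ∃ t : F, t ^ 2 + t = (γ⁻¹) ^ 2 + 1 := by
  refine ⟨a₁ * b₁ + γ * b₁ * a₂ + a₂ * b₂, ?_⟩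
  have hB : b₁ * a₂ + a₁ * b₂ = γ⁻¹ := by
    field_simp
    grind
  have hg : γ * γ⁻¹ = 1 := mul_inv_cancel₀ hγ0
  have hN : (a₁ * b₁ + γ * b₁ * a₂ + a₂ * b₂) ^ 2 +
      γ * (a₁ * b₁ + γ * b₁ * a₂ + a₂ * b₂) * (b₁ * a₂ + a₁ * b₂) +
      (b₁ * a₂ + a₁ * b₂) ^ 2 = 1 := by
    have : (a₁ ^ 2 + γ * a₁ * a₂ + a₂ ^ 2) * (b₁ ^ 2 + γ * b₁ * b₂ + b₂ ^ 2) = 1 := by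
      rw [ha, hb, one_mul]
    rw [← this]
    grind
  rw [hB] at hN
  grind

/-- For `q = 2^m` and `γ ∈ 𝔽_q` with `X² + γX + 1` irreducible over `𝔽_q`, the ellipse
`X² + γXY + Y² = 1` together with its nucleus `N = (0,0)` is a Sidon set in `𝔽_q × 𝔽_q`
if and only if `3` does not divide `|E| = q + 1`. -/
theorem ellipse_with_nucleus_sidon_iff (m : ℕ) (hm : 0 < m)
    (F : Type*) [Field F] [Fintype F] (hF : Fintype.card F = 2 ^ m)
    (γ : F)
    (hirr : Irreducible (Polynomial.X ^ 2 + Polynomial.C γ * Polynomial.X + 1 : Polynomial F))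
    (E : Set (F × F)) (hE : E = {p : F × F | p.1 ^ 2 + γ * p.1 * p.2 + p.2 ^ 2 = 1})
    (N : F × F) (hN : N = (0, 0)) :
    IsSidon (E ∪ {N}) ↔ ¬ (3 ∣ 2 ^ m + 1) := by
  classical
  have : CharP F 2 := by
    have : Fact (Nat.Prime 2) := ⟨Nat.prime_two⟩
    exact charP_of_card_eq_prime_pow hF
  subst hE hN
  have hγ : ∀ t : F, t ^ 2 + γ * t + 1 ≠ 0 := by
    intro t ht
    have hdeg := Polynomial.degree_eq_one_of_irreducible_of_root hirr
      (x := t) (by simpa [Polynomial.IsRoot] using ht)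
    have : (Polynomial.X ^ 2 + Polynomial.C γ * Polynomial.X + 1 : Polynomial F).degree = 2 := by
      compute_degree!
    rw [this] at hdeg
    norm_num at hdeg
  have hγ0 : γ ≠ 0 := by
    rintro rfl
    exact hγ 1 (by grind)
  have hnot : (γ⁻¹) ^ 2 ∉ (artinSchreierTwo F).range := by
    rintro ⟨t, ht⟩
    rw [artinSchreierTwo_apply] at ht
    apply hγ (γ * t)
    field_simp at ht
    grind
  have hdvd : ¬ 3 ∣ 2 ^ m + 1 ↔ 1 ∈ (artinSchreierTwo F).range := by
    have h := exists_sq_add_self_eq_one_iff F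
    rw [hF] at h
    rw [AddMonoidHom.mem_range]
    simp only [artinSchreierTwo_apply]
    rw [h]
    have h3 : ¬ 3 ∣ 2 ^ m := fun h ↦ by
      have := Nat.prime_three.dvd_of_dvd_pow h
      omega
    have : 0 < 2 ^ m := by positivity
    omega
  have hsum : ¬ 3 ∣ 2 ^ m + 1 ↔ (γ⁻¹) ^ 2 + 1 ∉ (artinSchreierTwo F).range := by
    rw [hdvd, AddSubgroup.add_mem_iff_of_index_two (index_range_artinSchreierTwo F)]
    tauto
  rw [hsum]
  constructor
  · rintro hS ⟨t, ht⟩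
    rw [artinSchreierTwo_apply] at ht
    have hi : γ⁻¹ ≠ 0 := inv_ne_zero hγ0
    have hg : γ * γ⁻¹ = 1 := mul_inv_cancel₀ hγ0
    refine hS (1, 0) (Or.inl ?_) (t, γ⁻¹) (Or.inl ?_) (1 + t, γ⁻¹) (Or.inl ?_) (0, 0)
      (Or.inr rfl) (Or.inr (Or.inl ⟨?_, ?_, ?_⟩)) ?_
    · simp
    · simp only [Set.mem_ofPred_eq]; grind
    · simp only [Set.mem_ofPred_eq]; grind
    · simp [hi.symm]
    · simp
    · simp [hi]
    · simp
  · have hthree : ∀ {a₁ a₂ b₁ b₂ c₁ c₂ : F}, a₁ ^ 2 + γ * a₁ * a₂ + a₂ ^ 2 = 1 →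
        b₁ ^ 2 + γ * b₁ * b₂ + b₂ ^ 2 = 1 → c₁ ^ 2 + γ * c₁ * c₂ + c₂ ^ 2 = 1 →
        a₁ + b₁ = c₁ → a₂ + b₂ = c₂ → (γ⁻¹) ^ 2 + 1 ∈ (artinSchreierTwo F).range := by
      rintro a₁ a₂ b₁ b₂ c₁ c₂ ha hb hc rfl rfl
      exact exists_of_add_mem_ellipse hγ0 ha hb hc
    rintro hrange ⟨x₁, x₂⟩ hx ⟨y₁, y₂⟩ hy ⟨z₁, z₂⟩ hz ⟨w₁, w₂⟩ hw hdist hEq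
    obtain ⟨h₁, h₂⟩ := Prod.mk.inj hEq
    simp only [Set.union_singleton, Set.mem_insert_iff, Set.mem_ofPred_eq, Prod.mk.injEq]
      at hx hy hz hw
    have hxy : ¬(x₁ = y₁ ∧ x₂ = y₂) := by
      rintro ⟨rfl, rfl⟩
      have h₁' : z₁ = w₁ := by grind
      have h₂' : z₂ = w₂ := by grind
      subst h₁' h₂'
      simp [ThreeDistinct] at hdist
    have hzx : ¬(z₁ = x₁ ∧ z₂ = x₂) := by
      rintro ⟨rfl, rfl⟩
      obtain rfl := add_left_cancel h₁
      obtain rfl := add_left_cancel h₂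
      simp [ThreeDistinct] at hdist
    have hzy : ¬(z₁ = y₁ ∧ z₂ = y₂) := by
      rintro ⟨rfl, rfl⟩
      obtain rfl : x₁ = w₁ := by grind
      obtain rfl : x₂ = w₂ := by grind
      simp [ThreeDistinct] at hdist
    have hwx : ¬(w₁ = x₁ ∧ w₂ = x₂) := by
      rintro ⟨rfl, rfl⟩
      exact hzy ⟨by linear_combination -h₁, by linear_combination -h₂⟩
    have hwy : ¬(w₁ = y₁ ∧ w₂ = y₂) := by
      rintro ⟨rfl, rfl⟩
      exact hzx ⟨by linear_combination -h₁, by linear_combination -h₂⟩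
    have hwz : ¬(w₁ = z₁ ∧ w₂ = z₂) := by
      rintro ⟨rfl, rfl⟩
      rw [CharTwo.add_self_eq_zero] at h₁ h₂
      exact hxy ⟨CharTwo.add_eq_zero.mp h₁, CharTwo.add_eq_zero.mp h₂⟩
    rcases hx with ⟨rfl, rfl⟩ | hx
    · exact hrange (hthree (hz.resolve_left hzx) (hw.resolve_left hwx)
        (hy.resolve_left fun h ↦ hxy ⟨h.1.symm, h.2.symm⟩)
        (by simpa using h₁.symm) (by simpa using h₂.symm))
    rcases hy with ⟨rfl, rfl⟩ | hy
    · exact hrange (hthree (hz.resolve_left hzy) (hw.resolve_left hwy) hx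
        (by simpa using h₁.symm) (by simpa using h₂.symm))
    rcases hz with ⟨rfl, rfl⟩ | hz
    · exact hrange (hthree hx hy (hw.resolve_left hwz) (by simpa using h₁) (by simpa using h₂))
    rcases hw with ⟨rfl, rfl⟩ | hw
    · exact hrange (hthree hx hy hz (by simpa using h₁) (by simpa using h₂))
    rcases eq_or_eq_of_add_eq_add_of_mem_ellipse hγ0 hγ hx hy hz hw h₁ h₂ hxy with h | h
    · exact hzx h
    · exact hzy h
end

section
/- Let $q=2^m\geq 16$ be a power of two and let $c\in\mathbb{F}_q$ with $c\neq 0$ and $c\neq 1$. Then there exist nonzero elements $x,y\in\mathbb{F}_q$ such that $x^2y+xy^2+cxy+x^2+y^2+x+y=0$. -/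
/-- The absolute trace of the field with `2 ^ (n + 1)` elements, as a power sum. -/
def absTrace {F : Type*} [Field F] (n : ℕ) (x : F) : F :=
  ∑ i ∈ Finset.range (n + 1), x ^ 2 ^ i

section AbsTrace

variable {F : Type*} [Field F] {n : ℕ}

theorem absTrace_zero : absTrace n (0 : F) = 0 :=
  Finset.sum_eq_zero fun i _ => zero_pow (pow_ne_zero i two_ne_zero)

theorem absTrace_add [CharP F 2] (x y : F) :
    absTrace n (x + y) = absTrace n x + absTrace n y := by
  simp only [absTrace, add_pow_char_pow, Finset.sum_add_distrib]

theorem absTrace_sq [Fintype F] (hF : Fintype.card F = 2 ^ (n + 1)) (x : F) :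
    absTrace n (x ^ 2) = absTrace n x := by
  have h : x ^ 2 ^ (n + 1) = x := hF ▸ FiniteField.pow_card x
  simp only [absTrace, ← pow_mul, ← pow_succ']
  rw [Finset.sum_range_succ, h, Finset.sum_range_succ' (fun i => x ^ 2 ^ i)]
  simp

theorem absTrace_eq_zero_or_one [Fintype F] [CharP F 2]
    (hF : Fintype.card F = 2 ^ (n + 1)) (x : F) :
    absTrace n x = 0 ∨ absTrace n x = 1 := by
  have h : absTrace n x ^ 2 = absTrace n x := by
    conv_rhs => rw [← absTrace_sq hF x]
    simp only [absTrace, sum_pow_char, ← pow_mul, mul_comm]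
  have h' : absTrace n x * (absTrace n x - 1) = 0 := by linear_combination h
  rcases mul_eq_zero.1 h' with h0 | h1
  · exact .inl h0
  · exact .inr (sub_eq_zero.1 h1)

open Polynomial in
theorem card_absTrace_eq_zero_le [Fintype F] [DecidableEq F] :
    (Finset.univ.filter fun x : F => absTrace n x = 0).card ≤ 2 ^ n := by
  by_contra! hlt
  set p : F[X] := ∑ i ∈ Finset.range (n + 1), X ^ 2 ^ i with hp
  have hdeg : p.natDegree ≤ 2 ^ n := by
    refine natDegree_sum_le_of_forall_le _ _ fun i hi => ?_
    rw [natDegree_X_pow]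
    exact Nat.pow_le_pow_right two_pos (Nat.lt_succ_iff.1 (Finset.mem_range.1 hi))
  have hp0 : p = 0 := by
    refine eq_zero_of_natDegree_lt_card_of_eval_eq_zero' p _ (fun x hx => ?_)
      (hdeg.trans_lt hlt)
    have hx0 : absTrace n x = 0 := (Finset.mem_filter.1 hx).2
    simpa [hp, eval_finsetSum, absTrace] using hx0
  have hcoeff : p.coeff (2 ^ n) = 1 := by
    simp [hp, finsetSum_coeff, coeff_X_pow, Nat.pow_right_injective le_rfl |>.eq_iff]
  simp [hp0] at hcoeff

theorem le_card_absTrace_eq_one [Fintype F] [DecidableEq F] [CharP F 2]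
    (hF : Fintype.card F = 2 ^ (n + 1)) :
    2 ^ n ≤ (Finset.univ.filter fun x : F => absTrace n x = 1).card := by
  have hcard := Finset.card_filter_add_card_filter_not (s := Finset.univ)
    (fun x : F => absTrace n x = 0)
  have hfilter : (Finset.univ.filter fun x : F => ¬ absTrace n x = 0) =
      Finset.univ.filter fun x : F => absTrace n x = 1 := by
    refine Finset.filter_congr fun x _ => ⟨(absTrace_eq_zero_or_one hF x).resolve_left, ?_⟩
    intro h
    simp [h]
  rw [hfilter, Finset.card_univ, hF, pow_succ] at hcard
  have := card_absTrace_eq_zero_le (F := F) (n := n)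
  omega

/-- Additive Hilbert 90 over `𝔽₂`. -/
theorem exists_sq_add_self_of_absTrace_eq_zero [Fintype F] [CharP F 2]
    (hF : Fintype.card F = 2 ^ (n + 1)) {z : F} (hz : absTrace n z = 0) :
    ∃ y : F, y ^ 2 + y = z := by
  classical
  have hsub : (Finset.univ.image fun y : F => y ^ 2 + y) ⊆
      Finset.univ.filter fun x : F => absTrace n x = 0 := by
    intro w hw
    obtain ⟨y, -, rfl⟩ := Finset.mem_image.1 hw
    simp [absTrace_add, absTrace_sq hF, CharTwo.add_self_eq_zero]
  have hfib : Fintype.card F ≤ 2 * (Finset.univ.image fun y : F => y ^ 2 + y).card := by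
    refine Finset.card_le_mul_card_image _ 2 fun w hw => ?_
    obtain ⟨y, -, rfl⟩ := Finset.mem_image.1 hw
    refine (Finset.card_le_card fun t ht => ?_).trans (Finset.card_le_two (a := y) (b := y + 1))
    have ht' : t ^ 2 + t = y ^ 2 + y := (Finset.mem_filter.1 ht).2
    have h : (t - y) * (t - (y + 1)) = 0 := by
      linear_combination ht' - (t + y * t - y ^ 2 - y) * CharTwo.two_eq_zero (R := F)
    rcases mul_eq_zero.1 h with h | h <;> simp [sub_eq_zero.1 h]
  have heq := Finset.eq_of_subset_of_card_le hsub (by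
    have := card_absTrace_eq_zero_le (F := F) (n := n)
    rw [hF, pow_succ] at hfib
    omega)
  have hmem : z ∈ Finset.univ.image fun y : F => y ^ 2 + y := by simp [heq, hz]
  simpa using hmem

open Polynomial in
/-- Inversion does not map the trace-one hyperplane, minus one point, into another one. -/
theorem exists_absTrace_eq_one_and_absTrace_div_ne_one [Fintype F] [CharP F 2]
    (hn : 3 ≤ n) (hF : Fintype.card F = 2 ^ (n + 1)) {b a : F} (hb : b ≠ 0) (ha : a ≠ 0) :
    ∃ s : F, absTrace n s = 1 ∧ s ≠ a ∧ absTrace n (b / s) ≠ 1 := by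
  classical
  by_contra! hall
  have h8 : 2 ^ 3 ≤ 2 ^ n := Nat.pow_le_pow_right two_pos hn
  have hpow : ∀ i ∈ Finset.range n, 2 * 2 ^ i ≤ 2 ^ n := fun i hi => by
    rw [← pow_succ']
    exact Nat.pow_le_pow_right two_pos (Finset.mem_range.1 hi)
  set Q : F[X] := C (a * b) * X ^ (2 ^ n - 1) +
    (X + C a) * (∑ i ∈ Finset.range n, C (b ^ 2 ^ (i + 1)) * X ^ (2 ^ n - 2 ^ (i + 1))) +
    (X + C (a + b)) * (1 + ∑ i ∈ Finset.range n, X ^ 2 ^ i) with hQ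
  have hdeg : Q.natDegree ≤ 2 ^ n - 1 := by
    have hlin (r : F) : (X + C r).natDegree ≤ 1 := (natDegree_X_add_C r).le
    refine natDegree_add_le_of_degree_le (natDegree_add_le_of_degree_le
      (natDegree_C_mul_X_pow_le _ _) ?_) ?_
    · refine (natDegree_mul_le_of_le (hlin a) (natDegree_sum_le_of_forall_le
        (n := 2 ^ n - 2) _ _ fun i _ => (natDegree_C_mul_X_pow_le _ _).trans ?_)).trans (by omega)
      have := Nat.one_le_two_pow (n := i)
      rw [pow_succ']
      omega
    · refine (natDegree_mul_le_of_le (hlin (a + b)) (natDegree_add_le_of_degree_le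
        (n := 2 ^ n - 2) (by simp) (natDegree_sum_le_of_forall_le _ _ fun i hi => ?_))).trans
          (by omega)
      have := hpow i hi
      rw [natDegree_X_pow]
      omega
  have hQ0 : Q = 0 := by
    refine eq_zero_of_natDegree_lt_card_of_eval_eq_zero' Q
      (Finset.univ.filter fun x : F => absTrace n x = 1) (fun s hs => ?_) ?_
    · have hs1 : absTrace n s = 1 := (Finset.mem_filter.1 hs).2
      have hs0 : s ≠ 0 := by
        rintro rfl
        simp [absTrace_zero] at hs1
      have hprod : (s + a) * (absTrace n (b / s) + 1) = 0 := by
        by_cases hsa : s = a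
        · simp [hsa, CharTwo.add_self_eq_zero]
        · simp [hall s hs1 hsa, CharTwo.add_self_eq_zero]
      have hsum : ∑ i ∈ Finset.range n, b ^ 2 ^ (i + 1) * s ^ (2 ^ n - 2 ^ (i + 1)) =
          s ^ 2 ^ n * ∑ i ∈ Finset.range n, (b / s) ^ 2 ^ (i + 1) := by
        rw [Finset.mul_sum]
        refine Finset.sum_congr rfl fun i hi => ?_
        have := hpow i hi
        rw [pow_sub₀ s hs0 (by rw [pow_succ']; exact this), div_pow]
        ring
      have hone : s ^ (2 ^ n - 1) = s ^ 2 ^ n * s⁻¹ := by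
        rw [pow_sub₀ s hs0 (by omega), pow_one]
      rw [absTrace, Finset.sum_range_succ] at hs1
      rw [absTrace, Finset.sum_range_succ', pow_zero, pow_one] at hprod
      simp only [hQ, eval_add, eval_mul, eval_C, eval_X, eval_pow, eval_finsetSum, eval_one, hsum,
        hone]
      set A := ∑ i ∈ Finset.range n, (b / s) ^ 2 ^ (i + 1)
      set B := ∑ i ∈ Finset.range n, s ^ 2 ^ i
      set N := s ^ 2 ^ n
      have h2 := CharTwo.two_eq_zero (R := F)
      have hss : s⁻¹ * s = 1 := inv_mul_cancel₀ hs0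
      rw [div_eq_mul_inv] at hprod
      linear_combination N * hprod + (s + a + b) * hs1 + (s + a + b) * (1 - N) * h2 - N * b * hss
    · have := le_card_absTrace_eq_one (F := F) hF
      omega
  have hcoeff : Q.coeff (2 ^ n - 2) = a * b ^ 2 := by
    have hS3 : (∑ i ∈ Finset.range n, C (b ^ 2 ^ (i + 1)) *
        X ^ (2 ^ n - 2 ^ (i + 1))).coeff (2 ^ n - 3) = 0 := by
      rw [finsetSum_coeff]
      refine Finset.sum_eq_zero fun i hi => ?_
      have := hpow i hi
      have : 2 ∣ 2 ^ n := dvd_pow_self 2 (by omega)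
      rw [coeff_C_mul_X_pow, if_neg (by rw [pow_succ']; omega)]
    have hS2 : (∑ i ∈ Finset.range n, C (b ^ 2 ^ (i + 1)) *
        X ^ (2 ^ n - 2 ^ (i + 1))).coeff (2 ^ n - 2) = b ^ 2 := by
      rw [finsetSum_coeff, Finset.sum_eq_single_of_mem 0 (Finset.mem_range.2 (by omega))]
      · rw [coeff_C_mul_X_pow, if_pos (by simp), zero_add, pow_one]
      · intro i hi hi0
        have := hpow i hi
        have := Nat.one_lt_two_pow hi0
        rw [coeff_C_mul_X_pow, if_neg (by rw [pow_succ']; omega)]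
    have hT (k : ℕ) (hk : 2 ^ n < 2 * k) :
        (1 + ∑ i ∈ Finset.range n, X ^ 2 ^ i : F[X]).coeff k = 0 := by
      rw [coeff_add, finsetSum_coeff, coeff_one, if_neg (by omega), zero_add]
      refine Finset.sum_eq_zero fun i hi => ?_
      have := hpow i hi
      rw [coeff_X_pow, if_neg (by omega)]
    have hmul (r : F) (p : F[X]) : ((X + C r) * p).coeff (2 ^ n - 2) =
        p.coeff (2 ^ n - 3) + r * p.coeff (2 ^ n - 2) := by
      rw [add_mul, coeff_add, coeff_C_mul, show 2 ^ n - 2 = 2 ^ n - 3 + 1 by omega, coeff_X_mul]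
    rw [hQ, coeff_add, coeff_add, hmul, hmul, hS3, hS2, hT _ (by omega), hT _ (by omega),
      coeff_C_mul_X_pow, if_neg (by omega)]
    ring
  rw [hQ0, coeff_zero] at hcoeff
  exact mul_ne_zero ha (pow_ne_zero 2 hb) hcoeff.symm

end AbsTrace

/-- For `q = 2^m ≥ 16` and `c ∈ 𝔽_q \ {0, 1}`, the cubic equation
`x²y + xy² + cxy + x² + y² + x + y = 0` has a solution with `x, y ≠ 0`. -/
theorem hyperbola_cubic_solution (m : ℕ)
    (F : Type*) [Field F] [Fintype F] (hF : Fintype.card F = 2 ^ m)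
    (hq : 16 ≤ Fintype.card F) (c : F) (hc0 : c ≠ 0) (hc1 : c ≠ 1) :
    ∃ x y : F, x ≠ 0 ∧ y ≠ 0 ∧
      x ^ 2 * y + x * y ^ 2 + c * x * y + x ^ 2 + y ^ 2 + x + y = 0 := by
  obtain ⟨n, rfl, hn⟩ : ∃ n, m = n + 1 ∧ 3 ≤ n := by
    have hm : 4 ≤ m := by
      rw [hF] at hq
      exact (Nat.pow_le_pow_iff_right one_lt_two).1 (show 2 ^ 4 ≤ 2 ^ m from hq)
    exact ⟨m - 1, by omega, by omega⟩
  have : CharP F 2 := charP_of_card_eq_prime_pow hF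
  have h2 := CharTwo.two_eq_zero (R := F)
  have hsq (z : F) : ∃ y, y ^ 2 = z := by
    obtain ⟨y, hy⟩ := FiniteField.isSquare_of_char_two (ringChar.eq_iff.2 this) z
    exact ⟨y, by rw [hy, sq]⟩
  by_cases hroot : ∃ x : F, x ^ 2 + c * x + 1 = 0
  · obtain ⟨x, hx⟩ := hroot
    obtain ⟨y, rfl⟩ := hsq x
    have hy : y ≠ 0 := by
      rintro rfl
      simp at hx
    exact ⟨y ^ 2, y, pow_ne_zero 2 hy, hy, by
      linear_combination y * hx + (y ^ 4 + y ^ 2) * h2⟩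
  push Not at hroot
  obtain ⟨d, rfl⟩ := hsq c
  have hd : d ≠ 0 := by
    rintro rfl
    simp at hc0
  have hd1 : 1 + d ≠ 0 := by
    intro h
    apply hc1
    linear_combination (1 + d) * h - (1 + d) * h2
  have htr : absTrace n (d ^ 2)⁻¹ = 1 := by
    refine (absTrace_eq_zero_or_one hF _).resolve_left fun h => ?_
    rw [← absTrace_sq hF] at h
    obtain ⟨y, hy⟩ := exists_sq_add_self_of_absTrace_eq_zero hF h
    apply hroot (d ^ 2 * y)
    field_simp at hy
    linear_combination hy + h2
  obtain ⟨s, hs1, hsa, hs⟩ := exists_absTrace_eq_one_and_absTrace_div_ne_one hn hF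
    (b := (1 + d) / d ^ 4) (a := (d ^ 2)⁻¹) (by positivity) (by positivity)
  have hs0 : s ≠ 0 := by
    rintro rfl
    simp [absTrace_zero] at hs1
  obtain ⟨v, hv⟩ : ∃ v, v = s + (d ^ 2)⁻¹ := ⟨_, rfl⟩
  have hv0 : v ≠ 0 := by
    rw [hv]
    exact fun h => hsa (CharTwo.add_eq_zero.1 h)
  have hvs : d ^ 2 * s = d ^ 2 * v + 1 := by
    rw [hv]
    field_simp
    linear_combination - h2
  have htv : absTrace n (v ^ 2) = 0 := by
    rw [absTrace_sq hF, hv, absTrace_add, hs1, htr, CharTwo.add_self_eq_zero]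
  obtain ⟨t, ht⟩ := exists_sq_add_self_of_absTrace_eq_zero hF htv
  obtain ⟨r, hr⟩ : ∃ r : F, r ^ 2 + r = v / (d ^ 2 * s) ^ 2 := by
    apply exists_sq_add_self_of_absTrace_eq_zero hF
    have hsplit : v / (d ^ 2 * s) ^ 2 = 1 / (d ^ 4 * s) + (1 / (d ^ 3 * s)) ^ 2 := by
      rw [hv]
      field_simp
    have hsplit' : (1 + d) / d ^ 4 / s = 1 / (d ^ 4 * s) + 1 / (d ^ 3 * s) := by
      field_simp
    rw [hsplit, absTrace_add, absTrace_sq hF, ← absTrace_add, ← hsplit']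
    exact (absTrace_eq_zero_or_one hF _).resolve_right hs
  have hr0 : r ≠ 0 := by
    rintro rfl
    have : v / (d ^ 2 * s) ^ 2 ≠ 0 := by positivity
    exact this (by simpa using hr.symm)
  have ht0 : t ≠ 0 := by
    rintro rfl
    exact pow_ne_zero 2 hv0 (by simpa using ht.symm)
  have htv1 : t + v ≠ 0 := by
    intro h
    have : t = v := CharTwo.add_eq_zero.1 h
    apply hv0
    linear_combination ht + (-t - v - 1) * this
  obtain ⟨x, hx⟩ : ∃ x, x = t / v := ⟨_, rfl⟩
  have hx0 : x ≠ 0 := hx ▸ div_ne_zero ht0 hv0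
  have hx1 : x + 1 ≠ 0 := by
    rw [hx, div_add_one hv0]
    exact div_ne_zero htv1 hv0
  have hxv : v * (1 + x ^ 2) = x := by
    rw [hx]
    field_simp
    linear_combination ht + (v ^ 2 - t) * h2
  obtain ⟨k, hk⟩ : ∃ k, k = d ^ 2 * s := ⟨_, rfl⟩
  have hk0 : k ≠ 0 := hk ▸ mul_ne_zero hc0 hs0
  rw [← hk] at hr hvs
  obtain ⟨y, hy⟩ : ∃ y, y = r * x * k / ((x + 1) * v) := ⟨_, rfl⟩
  refine ⟨x, y, hx0, by rw [hy]; positivity, ?_⟩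
  have hr' : r ^ 2 * k ^ 2 + r * k ^ 2 = v := by
    field_simp at hr
    linear_combination hr
  have hy' : y * (x + 1) * v = r * x * k := by
    rw [hy]
    field_simp
  have hxk : v * (x ^ 2 + d ^ 2 * x + 1) = x * k := by
    linear_combination hxv - x * hvs
  refine (mul_eq_zero_iff_left (mul_ne_zero hx1 (pow_ne_zero 2 hv0))).1 ?_
  linear_combination (y * (x + 1) * v + r * x * k + v * (x ^ 2 + d ^ 2 * x + 1)) * hy' +
    r * x * k * hxk + x ^ 2 * hr' + x * v * hxv + (x ^ 2 * v ^ 2 + x ^ 2 * v) * h2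
end
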